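/- arXiv:1106.5337 — 2 statements merged into one kernel-verified Lean document; each statement's English description precedes it below -/
import Mathlib

section
/- Let Γ be an infinite group generated by a finite generating family S = (s_1, …, s_d) and let G = Cay(Γ, S). Then 1 / γ(G) ≤ p_u(G). -/
open MeasureTheory Set

noncomputable section

variable {Γ : Type} [Group Γ] {d : ℕ}

/-- The edge `(g, i)` of the Cayley graph `Cay(Γ, S)` joins `g` and `g * S i`. -/
def Joins (S : Fin d → Γ) (e : Γ × Fin d) (u v : Γ) : Prop :=
  (u = e.1 ∧ v = e.1 * S e.2) ∨ (v = e.1 ∧ u = e.1 * S e.2)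

/-- `u` and `v` are connected by a path of `ω`-open edges. -/
def OpenConn (S : Fin d → Γ) (ω : Γ × Fin d → Bool) (u v : Γ) : Prop :=
  Relation.ReflTransGen (fun a b => ∃ e, ω e = true ∧ Joins S e a b) u v

/-- The cluster of `v` in `ω`. -/
def Cluster (S : Fin d → Γ) (ω : Γ × Fin d → Bool) (v : Γ) : Set Γ :=
  {u | OpenConn S ω v u}

/-- `P` is Bernoulli(`p`) bond percolation on `Cay(Γ, S)`. -/
def IsBernoulli (S : Fin d → Γ) (p : ℝ) (P : Measure (Γ × Fin d → Bool)) : Prop :=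
  IsProbabilityMeasure P ∧
    ∀ (s : Finset (Γ × Fin d)) (f : Γ × Fin d → Bool),
      P {ω | ∀ e ∈ s, ω e = f e} = ∏ e ∈ s, ENNReal.ofReal (if f e then p else 1 - p)

/-- `C` is an infinite cluster of `ω`. -/
def IsInfCluster (S : Fin d → Γ) (ω : Γ × Fin d → Bool) (C : Set Γ) : Prop :=
  (∃ v, C = Cluster S ω v) ∧ C.Infinite

/-- The event that there is exactly one infinite cluster. -/
def UniqueEvent (S : Fin d → Γ) : Set (Γ × Fin d → Bool) :=
  {ω | ∃! C : Set Γ, IsInfCluster S ω C}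

/-- The uniqueness threshold `p_u(Cay(Γ, S))`: the infimum of the set of `p ∈ [0,1]` such that
Bernoulli(`p`) bond percolation almost surely produces exactly one infinite cluster. -/
def pu (S : Fin d → Γ) : ℝ :=
  sInf {p | p ∈ Icc (0:ℝ) 1 ∧
    ∀ P : Measure (Γ × Fin d → Bool), IsBernoulli S p P → P (UniqueEvent S) = 1}

/-- `ed`, `vs` form a simple cycle of length `n` in `Cay(Γ, S)`: a closed self-avoiding
path `vs 0, vs 1, …, vs n = vs 0` traversing the pairwise distinct edges `ed 0, …, ed (n-1)`. -/
def IsCycle (S : Fin d → Γ) (n : ℕ) (ed : Fin n → Γ × Fin d) (vs : Fin (n + 1) → Γ) : Prop :=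
  0 < n ∧ vs (Fin.last n) = vs 0 ∧
    (∀ k : Fin n, Joins S (ed k) (vs k.castSucc) (vs k.succ)) ∧
    Function.Injective (fun k : Fin n => vs k.castSucc) ∧ Function.Injective ed

/-- The number of (rooted, oriented) simple cycles of length `n` through the vertex `1`. -/
def cycleCount (S : Fin d → Γ) (n : ℕ) : ℕ :=
  Nat.card {w : (Fin n → Γ × Fin d) × (Fin (n + 1) → Γ) //
    IsCycle S n w.1 w.2 ∧ w.2 0 = 1}

/-- `γ(Cay(Γ, S)) = limsup_n a_n^(1/n)`, the exponential growth rate of the number of simple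
cycles through a fixed vertex. -/
def gammaExp (S : Fin d → Γ) : ℝ :=
  Filter.limsup (fun n : ℕ => (cycleCount S n : ℝ) ^ ((n : ℝ)⁻¹)) Filter.atTop

section Graph

variable {V : Type*} {G : SimpleGraph V}

open SimpleGraph

/-- Two edges of a simple graph are on a common cycle. -/
def CommonCycle (G : SimpleGraph V) (e f : Sym2 V) : Prop :=
  ∃ (x : V) (C : G.Walk x x), C.IsCycle ∧ e ∈ C.edges ∧ f ∈ C.edges

lemma exists_walk_to_first_hit (A : Set V) {c a : V} (Q : G.Walk c a) (ha : a ∈ A) :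
    ∃ z, ∃ R : G.Walk c z, z ∈ A ∧ R.support ⊆ Q.support ∧ ∀ y ∈ R.support, y ∈ A → y = z := by
  induction Q with
  | nil => exact ⟨_, .nil, ha, by simp, by simp⟩
  | @cons u v w h q ih =>
    by_cases hu : u ∈ A
    · exact ⟨u, .nil, hu, by simp, by simp⟩
    · obtain ⟨z, R, hz, hR, h'⟩ := ih ha
      refine ⟨z, .cons h R, hz, ?_, ?_⟩
      · simp only [Walk.support_cons]
        exact List.cons_subset_cons _ hR
      · intro y hy hyA
        rw [Walk.support_cons, List.mem_cons] at hy
        rcases hy with rfl | hy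
        · exact absurd hyA hu
        · exact h' y hy hyA

lemma isPath_append_of_inter {u v w : V} {p : G.Walk u v} {q : G.Walk v w} (hp : p.IsPath)
    (hq : q.IsPath) (h : ∀ y ∈ p.support, y ∈ q.support → y = v) : (p.append q).IsPath := by
  rw [Walk.isPath_def, Walk.support_append, List.nodup_append']
  refine ⟨hp.support_nodup, hq.support_nodup.tail, ?_⟩
  intro y hy hy'
  have := h y hy (List.mem_of_mem_tail hy')
  subst this
  have hn := hq.support_nodup
  rw [← Walk.cons_tail_support] at hn
  exact (List.nodup_cons.1 hn).1 hy'

lemma exists_arc [DecidableEq V] {x : V} {C : G.Walk x x} (hC : C.IsCycle) {e : Sym2 V}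
    (he : e ∈ C.edges) {b z : V} (hb : b ∈ C.support) (hz : z ∈ C.support) (hbz : b ≠ z) :
    ∃ A : G.Walk b z, A.IsPath ∧ e ∈ A.edges ∧ A.support ⊆ C.support ∧ A.edges ⊆ C.edges := by
  have hD : (C.rotate b hb).IsCycle := (Walk.isCycle_rotate hb).2 hC
  have hz' : z ∈ (C.rotate b hb).support := (Walk.mem_support_rotate_iff _ _ _).2 hz
  have hs : (C.rotate b hb).support ⊆ C.support := fun y hy ↦
    (Walk.mem_support_rotate_iff _ _ _).1 hy
  have hes : (C.rotate b hb).edges ⊆ C.edges := fun y hy ↦ (C.rotate_edges b hb).mem_iff.1 hy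
  have he' : e ∈ (C.rotate b hb).edges := (C.rotate_edges b hb).mem_iff.2 he
  generalize C.rotate b hb = D at *
  have hspec := D.take_spec hz'
  rw [← hspec, Walk.edges_append, List.mem_append] at he'
  have hD' := hD
  rw [← hspec] at hD'
  rcases he' with he' | he'
  · exact ⟨D.takeUntil z hz', hD.isPath_takeUntil hz', he',
      fun y hy ↦ hs (D.support_takeUntil_subset_support hz' hy),
      fun y hy ↦ hes (D.edges_takeUntil_subset_edges hz' hy)⟩
  · refine ⟨(D.dropUntil z hz').reverse, ?_, by simpa using he', ?_, ?_⟩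
    · rw [Walk.isPath_reverse_iff]
      exact hD'.isPath_of_append_right (Walk.not_nil_of_ne hbz)
    · rw [Walk.support_reverse]
      exact fun y hy ↦ hs (D.support_dropUntil_subset_support hz' (List.mem_reverse.1 hy))
    · rw [Walk.edges_reverse]
      exact fun y hy ↦ hes (D.edges_dropUntil_subset_edges hz' (List.mem_reverse.1 hy))

/-- A cycle through `e` and the vertices `a ≠ b` can be rerouted through the edge `s(b, c)` if
`c` is connected to `a` off `b`. -/
lemma commonCycle_reroute {x : V} {C : G.Walk x x} (hC : C.IsCycle) {e : Sym2 V}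
    (he : e ∈ C.edges) {a b c : V} (ha : a ∈ C.support) (hb : b ∈ C.support)
    (hbc : G.Adj b c) (Q : G.Walk c a) (hQ : b ∉ Q.support) : CommonCycle G e s(b, c) := by
  classical
  by_cases hg : s(b, c) ∈ C.edges
  · exact ⟨x, C, hC, he, hg⟩
  obtain ⟨z, R, hz, hRQ, hR⟩ := exists_walk_to_first_hit {y | y ∈ C.support} Q ha
  have hbR : b ∉ R.support := fun h ↦ hQ (hRQ h)
  have hbz : b ≠ z := fun h ↦ hbR (h ▸ R.end_mem_support)
  obtain ⟨A, hA, heA, hAs, hAe⟩ := exists_arc hC he hb hz hbz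
  have hR' : ∀ y ∈ R.bypass.support, y ∈ R.support := R.support_bypass_subset_support
  have hpath : (A.append R.bypass.reverse).IsPath := by
    refine isPath_append_of_inter hA ((Walk.isPath_reverse_iff _).2 R.bypass_isPath) ?_
    intro y hy hy'
    rw [Walk.support_reverse, List.mem_reverse] at hy'
    exact hR y (hR' y hy') (hAs hy)
  refine ⟨c, .cons hbc.symm (A.append R.bypass.reverse), ?_, ?_, ?_⟩
  · rw [Walk.cons_isCycle_iff]
    refine ⟨hpath, ?_⟩
    rw [Walk.edges_append, List.mem_append, Walk.edges_reverse, List.mem_reverse]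
    rintro (h | h)
    · exact hg (by rw [Sym2.eq_swap]; exact hAe h)
    · exact hbR (hR' _ (Walk.snd_mem_support_of_mem_edges _ h))
  · simp [heA]
  · simp [Sym2.eq_swap]

/-- If no vertex of a path separates its two neighbours on the path, then the first edge of the
path is on a common cycle with every later edge. -/
lemma commonCycle_ray {r : ℕ → V} (hadj : ∀ k, G.Adj (r k) (r (k + 1)))
    (hr : Function.Injective r) (hQ : ∀ k, ∃ Q : G.Walk (r (k + 2)) (r k), r (k + 1) ∉ Q.support)
    (k : ℕ) : CommonCycle G s(r 0, r 1) s(r (k + 1), r (k + 2)) := by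
  classical
  induction k with
  | zero =>
    obtain ⟨Q, hQ⟩ := hQ 0
    refine ⟨r 1, .cons (hadj 1) (.append Q.bypass (.cons (hadj 0) .nil)), ?_, ?_, ?_⟩
    · rw [Walk.cons_isCycle_iff]
      constructor
      · refine isPath_append_of_inter Q.bypass_isPath (by simp [hr.eq_iff]) ?_
        intro y hy hy'
        simp only [Walk.support_cons, Walk.support_nil, List.mem_cons, List.not_mem_nil,
          or_false] at hy'
        rcases hy' with rfl | rfl
        · rfl
        · exact absurd (Q.support_bypass_subset_support hy) hQ
      · rw [Walk.edges_append, List.mem_append]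
        rintro (h | h)
        · exact hQ (Q.support_bypass_subset_support (Walk.fst_mem_support_of_mem_edges _ h))
        · simp [hr.eq_iff] at h
    · simp
    · simp
  | succ k ih =>
    obtain ⟨x, C, hC, he, hf⟩ := ih
    obtain ⟨Q, hQ⟩ := hQ (k + 1)
    exact commonCycle_reroute hC he (Walk.fst_mem_support_of_mem_edges _ hf)
      (Walk.snd_mem_support_of_mem_edges _ hf) (hadj (k + 2)) Q hQ

/-- An infinite connected component of a locally finite graph contains a ray. -/
lemma exists_ray (hfin : ∀ v, {w | G.Adj v w}.Finite) {o : V}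
    (ho : {u | G.Reachable o u}.Infinite) :
    ∃ r : ℕ → V, r 0 = o ∧ Function.Injective r ∧ ∀ k, G.Adj (r k) (r (k + 1)) := by
  classical
  let D : V → Set V := fun u ↦ {v | ∃ p : G.Walk u v, p.length + G.dist o u = G.dist o v}
  have step : ∀ u : {u // G.Reachable o u ∧ (D u).Infinite}, ∃ w : {u // G.Reachable o u ∧
      (D u).Infinite}, G.Adj u w ∧ G.dist o w = G.dist o u + 1 := by
    rintro ⟨u, hu, hD⟩
    have hsub : D u ⊆ {u} ∪ ⋃ w ∈ {w | G.Adj u w ∧ G.dist o w = G.dist o u + 1}, D w := by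
      rintro v ⟨p, hp⟩
      cases p with
      | nil => exact Or.inl rfl
      | @cons _ w _ h q =>
        right
        rw [Walk.length_cons] at hp
        have h1 : G.dist o v ≤ G.dist o w + q.length :=
          (hu.trans h.reachable).dist_triangle_left v |>.trans
            (Nat.add_le_add_left (dist_le q) _)
        have h2 : G.dist o w ≤ G.dist o u + 1 :=
          (hu.dist_triangle_left w).trans (Nat.add_le_add_left (dist_le h.toWalk) _)
        simp only [mem_iUnion]
        exact ⟨w, ⟨h, by omega⟩, q, by omega⟩
    by_contra hcon
    push Not at hcon
    refine hD (((finite_singleton u).union (Finite.biUnion ((hfin u).subset fun w h ↦ h.1)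
      ?_)).subset hsub)
    rintro w ⟨h, hd⟩
    by_contra hinf
    exact hcon ⟨w, hu.trans h.reachable, hinf⟩ h hd
  choose f hf hfd using step
  have h0 : (D o).Infinite := by
    refine ho.mono fun u hu ↦ ?_
    obtain ⟨p, hp⟩ := Reachable.exists_walk_length_eq_dist (show G.Reachable o u from hu)
    exact ⟨p, by simp [hp]⟩
  let s : ℕ → {u // G.Reachable o u ∧ (D u).Infinite} := fun n ↦ f^[n] ⟨o, Reachable.refl o, h0⟩
  have hs : ∀ n, s (n + 1) = f (s n) := fun n ↦ Function.iterate_succ_apply' f n _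
  have hd : ∀ n, G.dist o (s n) = n := by
    intro n
    induction n with
    | zero => simp [s]
    | succ n ih => rw [hs, hfd, ih]
  refine ⟨fun n ↦ s n, rfl, fun m n h ↦ ?_, fun k ↦ ?_⟩
  · have h' : (s m : V) = s n := h
    rw [← hd m, ← hd n, h']
  · simp only [hs]
    exact hf _

lemma finite_walk_ball (hfin : ∀ v, {w | G.Adj v w}.Finite) (o : V) (n : ℕ) :
    {u | ∃ p : G.Walk o u, p.length ≤ n}.Finite := by
  induction n generalizing o with
  | zero =>
    refine (finite_singleton o).subset ?_
    rintro u ⟨p, hp⟩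
    exact (Walk.eq_of_length_eq_zero (Nat.le_zero.1 hp)).symm
  | succ n ih =>
    refine ((finite_singleton o).union (Finite.biUnion (hfin o) fun w _ ↦ ih w)).subset ?_
    rintro u ⟨p, hp⟩
    cases p with
    | nil => exact Or.inl rfl
    | @cons _ w _ h q =>
      right
      simp only [mem_iUnion]
      exact ⟨w, h, q, by simpa using hp⟩

/-- If the cycles through each vertex have bounded length, a ray has infinitely many vertices that
separate their two neighbours on the ray. -/
lemma infinite_cut_ray (hfin : ∀ v, {w | G.Adj v w}.Finite)
    (hcyc : ∀ v, ∃ L, ∀ C : G.Walk v v, C.IsCycle → C.length ≤ L) {r : ℕ → V}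
    (hadj : ∀ k, G.Adj (r k) (r (k + 1))) (hr : Function.Injective r) (N : ℕ) :
    ∃ k ≥ N, ∀ Q : G.Walk (r (k + 2)) (r k), r (k + 1) ∈ Q.support := by
  classical
  by_contra! hcon
  obtain ⟨L, hL⟩ := hcyc (r N)
  have key := commonCycle_ray (r := fun k ↦ r (N + k)) (fun k ↦ hadj _)
    (fun a b h ↦ by have := hr h; omega) (fun k ↦ hcon (N + k) (by omega))
  refine Set.infinite_range_of_injective (f := fun k ↦ r (N + (k + 1)))
    (fun a b h ↦ by have := hr h; omega) ((finite_walk_ball hfin (r N) L).subset ?_)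
  rintro _ ⟨k, rfl⟩
  obtain ⟨x, C, hC, he, hf⟩ := key k
  have h1 : r N ∈ C.support := Walk.fst_mem_support_of_mem_edges _ he
  have h2 : r (N + (k + 1)) ∈ C.support := Walk.fst_mem_support_of_mem_edges _ hf
  have h3 := (Walk.mem_support_rotate_iff C (r N) h1).2 h2
  refine ⟨(C.rotate (r N) h1).takeUntil _ h3, ?_⟩
  exact (Walk.length_takeUntil_le_length _ h3).trans (hL _ ((Walk.isCycle_rotate h1).2 hC))

end Graph

section Separation

variable {V : Type*} {G H : SimpleGraph V}

open SimpleGraph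

lemma not_reachable_deleteIncidenceSet {c u : V} (huc : u ≠ c) :
    ¬ (G.deleteIncidenceSet c).Reachable u c := by
  rintro ⟨p⟩
  have h := (p.reverse.adj_snd (Walk.not_nil_of_ne huc.symm))
  rw [deleteIncidenceSet_adj] at h
  exact h.2.1 rfl

lemma reachable_deleteIncidenceSet_of_walk {c u v : V} (p : G.Walk u v) (hc : c ∉ p.support) :
    (G.deleteIncidenceSet c).Reachable u v := by
  induction p with
  | nil => exact Reachable.refl _
  | cons h q ih =>
    rw [Walk.support_cons, List.mem_cons, not_or] at hc
    refine Reachable.trans (Adj.reachable ?_) (ih hc.2)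
    rw [deleteIncidenceSet_adj]
    exact ⟨h, fun h' ↦ hc.1 h'.symm, fun h' ↦ hc.2 (h' ▸ q.start_mem_support)⟩

lemma exists_walk_of_reachable_deleteIncidenceSet {c u v : V} (huc : u ≠ c)
    (h : (G.deleteIncidenceSet c).Reachable u v) : ∃ p : G.Walk u v, c ∉ p.support := by
  classical
  obtain ⟨p⟩ := h
  refine ⟨p.mapLe (deleteIncidenceSet_le G c), fun hc ↦ ?_⟩
  rw [Walk.support_mapLe_eq_support] at hc
  exact not_reachable_deleteIncidenceSet huc ⟨p.takeUntil c hc⟩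

lemma exists_adj_reachable_deleteIncidenceSet {c u : V} (p : G.Walk u c) (huc : u ≠ c) :
    ∃ w, G.Adj c w ∧ (G.deleteIncidenceSet c).Reachable u w := by
  induction p with
  | nil => exact absurd rfl huc
  | @cons u v c h q ih =>
    by_cases hv : v = c
    · subst hv
      exact ⟨u, h.symm, Reachable.refl _⟩
    · obtain ⟨w, hw, hr⟩ := ih hv
      refine ⟨w, hw, Reachable.trans (Adj.reachable ?_) hr⟩
      rw [deleteIncidenceSet_adj]
      exact ⟨h, huc, hv⟩

/-- The component of `v` in `G` is infinite. -/
def InfComp (G : SimpleGraph V) (v : V) : Prop := {u | G.Reachable v u}.Infinite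

/-- Among the vertices satisfying `I`, the vertex `y` is one of the nearest to `v` in `H`. -/
def Nearest (H : SimpleGraph V) (I : V → Prop) (v y : V) : Prop :=
  I y ∧ ∃ n, (∃ p : H.Walk v y, p.length = n) ∧
    ∀ z, I z → ∀ m, (∃ q : H.Walk v z, q.length = m) → n ≤ m

lemma exists_nearest {I : V → Prop} {v z : V} (hz : I z) (h : H.Reachable v z) :
    ∃ y, Nearest H I v y := by
  classical
  have hex : ∃ n, ∃ y, I y ∧ ∃ p : H.Walk v y, p.length = n := by
    obtain ⟨p⟩ := h
    exact ⟨_, z, hz, p, rfl⟩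
  obtain ⟨y, hy, hp⟩ := Nat.find_spec hex
  exact ⟨y, hy, _, hp, fun z hz m hq ↦ Nat.find_min' hex ⟨z, hz, hq⟩⟩

/-- Let `G ≤ H` where `G` has a unique infinite component even after isolating a vertex. If cycles
of `H` through each vertex have bounded length and each vertex is the chosen nearest point of
finitely many vertices, then each vertex of the infinite component is separated from infinity in `H`
by infinitely many vertices. -/
lemma infinite_cut_vertices (hGH : G ≤ H) (hfin : ∀ v, {w | H.Adj v w}.Finite)
    (hcyc : ∀ v, ∃ L, ∀ C : H.Walk v v, C.IsCycle → C.length ≤ L)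
    (huniq : ∀ u v, InfComp G u → InfComp G v → G.Reachable u v)
    (hdel : ∀ c u v, InfComp (G.deleteIncidenceSet c) u → InfComp (G.deleteIncidenceSet c) v →
      (G.deleteIncidenceSet c).Reachable u v)
    {φ : V → V → Prop} (hφ : ∀ v y, φ v y → Nearest H (InfComp G) v y)
    (hφex : ∀ v, (∃ y, Nearest H (InfComp G) v y) → ∃ y, φ v y)
    (hφfin : ∀ y, {v | φ v y}.Finite) {o : V} (ho : InfComp G o) :
    {c | {u | (H.deleteIncidenceSet c).Reachable o u}.Finite}.Infinite := by
  classical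
  have hdGH : ∀ c, G.deleteIncidenceSet c ≤ H.deleteIncidenceSet c := by
    intro c u v
    simp only [deleteIncidenceSet_adj]
    exact fun h ↦ ⟨hGH h.1, h.2⟩
  obtain ⟨r, r0, hr, hadj⟩ :=
    exists_ray (fun v ↦ (hfin v).subset fun w hw ↦ hGH hw) ho
  have hray : ∀ k, G.Reachable o (r k) := by
    intro k
    induction k with
    | zero => rw [r0]
    | succ k ih => exact ih.trans (hadj k).reachable
  have hI : ∀ k, InfComp G (r k) := by
    intro k
    refine Set.Infinite.mono (fun u hu ↦ ?_) ho
    exact (hray k).symm.trans hu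
  have hcut := infinite_cut_ray hfin hcyc (fun k ↦ hGH (hadj k)) hr
  have hinf : {k | ∀ Q : H.Walk (r (k + 2)) (r k), r (k + 1) ∈ Q.support}.Infinite := by
    rw [← Nat.frequently_atTop_iff_infinite, Filter.frequently_atTop]
    exact hcut
  refine (hinf.image (f := fun k ↦ r (k + 1))
    (fun a _ b _ h ↦ by have := hr h; omega)).mono ?_
  rintro _ ⟨k, hk, rfl⟩
  simp only [mem_ofPred_eq] at hk ⊢
  have hne : ∀ j, j ≠ k + 1 → r j ≠ r (k + 1) := fun j hj h ↦ hj (hr h)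
  have hedge : ∀ j, j ≠ k + 1 → j + 1 ≠ k + 1 →
      (G.deleteIncidenceSet (r (k + 1))).Adj (r j) (r (j + 1)) := by
    intro j h1 h2
    rw [deleteIncidenceSet_adj]
    exact ⟨hadj j, hne _ h1, hne _ h2⟩
  have hstart : ∀ j ≤ k, (G.deleteIncidenceSet (r (k + 1))).Reachable o (r j) := by
    intro j
    induction j with
    | zero => intro _; rw [r0]
    | succ j ih =>
      intro hj
      exact (ih (by omega)).trans (hedge j (by omega) (by omega)).reachable
  have htail : ∀ j, (G.deleteIncidenceSet (r (k + 1))).Reachable (r (k + 2)) (r (k + 2 + j)) := by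
    intro j
    induction j with
    | zero => exact Reachable.refl _
    | succ j ih => exact ih.trans (hedge _ (by omega) (by omega)).reachable
  have hc : ∀ j, j ≠ k + 1 → r j ≠ r (k + 1) := fun j hj h ↦ hj (hr h)
  have hIc := hI (k + 1)
  have htinf : InfComp (G.deleteIncidenceSet (r (k + 1))) (r (k + 2)) := by
    refine (Set.infinite_range_of_injective (f := fun j ↦ r (k + 2 + j))
      (fun a b h ↦ by have := hr h; omega)).mono ?_
    rintro _ ⟨j, rfl⟩
    exact htail j
  have hsep : ¬ (H.deleteIncidenceSet (r (k + 1))).Reachable (r (k + 2)) (r k) := by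
    intro h
    obtain ⟨p, hp⟩ := exists_walk_of_reachable_deleteIncidenceSet (hc _ (by omega)) h
    exact hp (hk p)
  have hok := (hstart k le_rfl).mono (hdGH _)
  have hoc : o ≠ r (k + 1) := r0 ▸ hc 0 (by omega)
  have hcr := hray (k + 1)
  generalize r (k + 1) = c at *
  have hfar : ∀ u, (H.deleteIncidenceSet c).Reachable o u →
      ¬ (H.deleteIncidenceSet c).Reachable u (r (k + 2)) :=
    fun u hu h ↦ hsep (h.symm.trans (hu.symm.trans hok))
  have hDI : {u | (H.deleteIncidenceSet c).Reachable o u ∧ InfComp G u}.Finite := by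
    refine (Finite.biUnion
      (s := {w | H.Adj c w ∧ {x | (G.deleteIncidenceSet c).Reachable w x}.Finite})
      (t := fun w ↦ {x | (G.deleteIncidenceSet c).Reachable w x})
      ((hfin c).subset fun w hw ↦ hw.1) fun w hw ↦ hw.2).subset ?_
    rintro u ⟨hu, hIu⟩
    have huc : u ≠ c := by
      rintro rfl
      exact not_reachable_deleteIncidenceSet hoc hu
    obtain ⟨p⟩ := huniq u c hIu hIc
    obtain ⟨w, hw, hr⟩ := exists_adj_reachable_deleteIncidenceSet p huc
    simp only [mem_iUnion]
    refine ⟨w, ⟨hGH hw, ?_⟩, hr.symm⟩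
    by_contra hinf
    exact hfar u hu ((hr.trans (hdel c w _ hinf htinf)).mono (hdGH c))
  refine ((hDI.union (finite_singleton c)).biUnion fun y _ ↦ hφfin y).subset ?_
  intro v hv
  obtain ⟨y, hy⟩ := hφex v (exists_nearest ho (hv.symm.mono (deleteIncidenceSet_le H c)))
  simp only [mem_iUnion]
  refine ⟨y, ?_, hy⟩
  obtain ⟨hIy, n, ⟨p, rfl⟩, hmin⟩ := hφ v y hy
  by_cases hcp : c ∈ p.support
  · right
    by_contra hcy
    have h1 := hmin c hIc _ ⟨p.takeUntil c hcp, rfl⟩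
    have h2 := Walk.length_takeUntil_lt_length hcp (fun h ↦ hcy h.symm)
    omega
  · exact Or.inl ⟨Reachable.trans hv (reachable_deleteIncidenceSet_of_walk p hcp), hIy⟩

end Separation

section OpenGraph

open SimpleGraph

/-- The simple graph of `ω`-open edges. -/
def openGraph (S : Fin d → Γ) (ω : Γ × Fin d → Bool) : SimpleGraph Γ where
  Adj u v := u ≠ v ∧ ∃ e, ω e = true ∧ Joins S e u v
  symm := ⟨fun _ _ h ↦ ⟨h.1.symm, h.2.imp fun _ he ↦ ⟨he.1, he.2.symm⟩⟩⟩
  loopless := ⟨fun _ h ↦ h.1 rfl⟩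

lemma openGraph_adj {S : Fin d → Γ} {ω : Γ × Fin d → Bool} {u v : Γ} :
    (openGraph S ω).Adj u v ↔ u ≠ v ∧ ∃ e, ω e = true ∧ Joins S e u v := Iff.rfl

lemma openConn_iff_reachable {S : Fin d → Γ} {ω : Γ × Fin d → Bool} {u v : Γ} :
    OpenConn S ω u v ↔ (openGraph S ω).Reachable u v := by
  constructor
  · intro h
    induction h with
    | refl => exact Reachable.refl _
    | @tail b c _ h ih =>
      by_cases hbc : b = c
      · exact hbc ▸ ih
      · exact ih.trans (Adj.reachable ⟨hbc, h⟩)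
  · rintro ⟨p⟩
    induction p with
    | nil => exact Relation.ReflTransGen.refl
    | cons h _ ih => exact Relation.ReflTransGen.head h.2 ih

lemma cluster_eq {S : Fin d → Γ} {ω : Γ × Fin d → Bool} {v : Γ} :
    Cluster S ω v = {u | (openGraph S ω).Reachable v u} := by
  ext u
  exact openConn_iff_reachable

lemma mem_uniqueEvent_iff {S : Fin d → Γ} {ω : Γ × Fin d → Bool} :
    ω ∈ UniqueEvent S ↔ (∃ v, InfComp (openGraph S ω) v) ∧
      ∀ u v, InfComp (openGraph S ω) u → InfComp (openGraph S ω) v →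
        (openGraph S ω).Reachable u v := by
  constructor
  · rintro ⟨C, ⟨⟨v, rfl⟩, hC⟩, huniq⟩
    rw [cluster_eq] at hC huniq
    refine ⟨⟨v, hC⟩, fun u w hu hw ↦ ?_⟩
    have h1 := huniq _ ⟨⟨u, cluster_eq.symm⟩, hu⟩
    have h2 := huniq _ ⟨⟨w, cluster_eq.symm⟩, hw⟩
    have h3 : w ∈ {x | (openGraph S ω).Reachable u x} := by
      rw [h1.trans h2.symm]
      exact Reachable.refl _
    exact h3
  · rintro ⟨⟨v, hv⟩, huniq⟩
    refine ⟨Cluster S ω v, ⟨⟨v, rfl⟩, by rwa [cluster_eq]⟩, ?_⟩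
    rintro _ ⟨⟨u, rfl⟩, hu⟩
    rw [cluster_eq] at hu
    have huv := huniq u v hu hv
    rw [cluster_eq, cluster_eq]
    ext w
    exact ⟨fun h ↦ huv.symm.trans h, fun h ↦ huv.trans h⟩

lemma openGraph_mono {S : Fin d → Γ} {ω ω' : Γ × Fin d → Bool}
    (h : ∀ e, ω e = true → ω' e = true) : openGraph S ω ≤ openGraph S ω' :=
  fun _ _ huv ↦ ⟨huv.1, huv.2.imp fun e he ↦ ⟨h e he.1, he.2⟩⟩

lemma finite_setOf_openGraph_adj (S : Fin d → Γ) (ω : Γ × Fin d → Bool) (v : Γ) :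
    {w | (openGraph S ω).Adj v w}.Finite := by
  refine ((finite_range fun i ↦ v * S i).union (finite_range fun i ↦ v * (S i)⁻¹)).subset ?_
  rintro w ⟨_, ⟨g, i⟩, _, ⟨rfl, h⟩ | ⟨rfl, h⟩⟩
  · exact Or.inl ⟨i, h.symm⟩
  · exact Or.inr ⟨i, by simp [h]⟩

open Classical in
/-- The edges incident to `c`. -/
def edgeStar (S : Fin d → Γ) (c : Γ) : Finset (Γ × Fin d) :=
  Finset.univ.image (fun i ↦ (c, i)) ∪ Finset.univ.image (fun i ↦ (c * (S i)⁻¹, i))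

lemma mem_edgeStar {S : Fin d → Γ} {c : Γ} {e : Γ × Fin d} :
    e ∈ edgeStar S c ↔ e.1 = c ∨ e.1 * S e.2 = c := by
  obtain ⟨g, i⟩ := e
  simp [edgeStar, eq_comm, eq_mul_inv_iff_mul_eq]

lemma card_edgeStar_le (S : Fin d → Γ) (c : Γ) : (edgeStar S c).card ≤ 2 * d := by
  classical
  refine (Finset.card_union_le _ _).trans ?_
  have h1 := Finset.card_image_le (s := (Finset.univ : Finset (Fin d))) (f := fun i ↦ (c, i))
  have h2 := Finset.card_image_le (s := (Finset.univ : Finset (Fin d)))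
    (f := fun i ↦ (c * (S i)⁻¹, i))
  rw [Finset.card_fin] at h1 h2
  omega

lemma finite_setOf_not_disjoint_edgeStar (S : Fin d → Γ) (F : Finset (Γ × Fin d)) :
    {c | ¬ Disjoint (edgeStar S c) F}.Finite := by
  refine (Finite.biUnion F.finite_toSet (t := fun e ↦ {e.1, e.1 * S e.2})
    fun e _ ↦ toFinite _).subset ?_
  intro c hc
  obtain ⟨e, he, heF⟩ := Finset.not_disjoint_iff.1 hc
  simp only [mem_iUnion]
  refine ⟨e, heF, ?_⟩
  rcases mem_edgeStar.1 he with h | h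
  · exact Or.inl h.symm
  · exact Or.inr h.symm

open Classical in
/-- The configuration equal to `ξ` on `F` and to `ω` off `F`. -/
def mix {E : Type*} (F : Finset E) (ω ξ : E → Bool) : E → Bool :=
  fun e ↦ if e ∈ F then ξ e else ω e

lemma openGraph_mix_edgeStar (S : Fin d → Γ) (ω : Γ × Fin d → Bool) (c : Γ) :
    openGraph S (mix (edgeStar S c) ω fun _ ↦ false) = (openGraph S ω).deleteIncidenceSet c := by
  classical
  ext u v
  rw [deleteIncidenceSet_adj, openGraph_adj, openGraph_adj]
  have key : ∀ e, Joins S e u v → (e ∉ edgeStar S c ↔ u ≠ c ∧ v ≠ c) := by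
    rintro e (⟨rfl, rfl⟩ | ⟨rfl, rfl⟩)
    · rw [mem_edgeStar, not_or]
    · rw [mem_edgeStar, not_or, and_comm]
  constructor
  · rintro ⟨hne, e, he, hj⟩
    have hs : e ∉ edgeStar S c := fun h ↦ by simp [mix, h] at he
    exact ⟨⟨hne, e, by simpa [mix, hs] using he, hj⟩, (key e hj).1 hs⟩
  · rintro ⟨⟨hne, e, he, hj⟩, hc⟩
    have hs := (key e hj).2 hc
    exact ⟨hne, e, by simpa [mix, hs] using he, hj⟩

lemma Joins.eq_or_swap {S : Fin d → Γ} {e : Γ × Fin d} {u v u' v' : Γ} (h : Joins S e u v)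
    (h' : Joins S e u' v') : (u = u' ∧ v = v') ∨ (u = v' ∧ v = u') := by
  unfold Joins at h h'
  grind

lemma getVert_eq_cases {V : Type*} {G : SimpleGraph V} {v : V} {C : G.Walk v v} (hC : C.IsCycle)
    {i j : ℕ} (hi : i ≤ C.length) (hj : j ≤ C.length) (h : C.getVert i = C.getVert j) :
    i = j ∨ (i = 0 ∧ j = C.length) ∨ (i = C.length ∧ j = 0) := by
  have h0 : C.getVert 0 = C.getVert C.length := by simp
  have hinj := hC.getVert_injOn
  have hlen := hC.three_le_length
  rcases Nat.eq_zero_or_pos i with rfl | hi' <;> rcases Nat.eq_zero_or_pos j with rfl | hj'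
  · exact Or.inl rfl
  · have := hinj (x₁ := C.length) (x₂ := j) ⟨by omega, le_rfl⟩ ⟨hj', hj⟩ (h0 ▸ h)
    omega
  · have := hinj (x₁ := i) (x₂ := C.length) ⟨hi', hi⟩ ⟨by omega, le_rfl⟩ (h0 ▸ h)
    omega
  · exact Or.inl (hinj ⟨hi', hi⟩ ⟨hj', hj⟩ h)

lemma exists_isCycle_of_walk {S : Fin d → Γ} {ω : Γ × Fin d → Bool} {v : Γ}
    {C : (openGraph S ω).Walk v v} (hC : C.IsCycle) :
    ∃ ed vs, IsCycle S C.length ed vs ∧ vs 0 = v ∧ ∀ k, ω (ed k) = true := by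
  have hadj : ∀ k : Fin C.length, ∃ e, ω e = true ∧ Joins S e (C.getVert k) (C.getVert (k + 1)) :=
    fun k ↦ (C.adj_getVert_succ k.2).2
  have hlen := hC.three_le_length
  choose ed hω hJ using hadj
  refine ⟨ed, fun k ↦ C.getVert k, ⟨by omega, by simp, fun k ↦ by simpa using hJ k, ?_, ?_⟩,
    by simp, hω⟩
  · intro i j h
    have := getVert_eq_cases hC i.2.le j.2.le h
    have := i.2
    have := j.2
    ext
    omega
  · intro i j h
    have h1 := hJ i
    rw [h] at h1
    have := i.2
    have := j.2
    rcases h1.eq_or_swap (hJ j) with ⟨h2, _⟩ | ⟨h2, h3⟩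
    · have := getVert_eq_cases hC i.2.le j.2.le h2
      ext
      omega
    · have := getVert_eq_cases hC i.2.le (Nat.succ_le_of_lt j.2) h2
      have := getVert_eq_cases hC (Nat.succ_le_of_lt i.2) j.2.le h3
      ext
      omega

end OpenGraph

section Percolation

open scoped ENNReal

/-- The law of a `{0, 1}`-valued random variable with mean `p`. -/
def bern (p : ℝ) : Measure Bool :=
  ENNReal.ofReal p • Measure.dirac true + ENNReal.ofReal (1 - p) • Measure.dirac false

lemma bern_singleton (p : ℝ) (b : Bool) : bern p {b} = ENNReal.ofReal (if b then p else 1 - p) := by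
  cases b <;> simp [bern]

lemma isProbabilityMeasure_bern {p : ℝ} (hp : p ∈ Icc (0 : ℝ) 1) :
    IsProbabilityMeasure (bern p) := by
  constructor
  have h : ENNReal.ofReal p + ENNReal.ofReal (1 - p) = 1 := by
    rw [← ENNReal.ofReal_add hp.1 (sub_nonneg.2 hp.2)]
    simp
  simpa [bern] using h

/-- Bernoulli(`p`) percolation on the edge set `E`. -/
def perc (E : Type*) (p : ℝ) : Measure (E → Bool) := Measure.infinitePi fun _ ↦ bern p

variable {E : Type*} {p q : ℝ}

lemma isProbabilityMeasure_perc (hp : p ∈ Icc (0 : ℝ) 1) : IsProbabilityMeasure (perc E p) := by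
  have := isProbabilityMeasure_bern hp
  unfold perc
  infer_instance

lemma perc_cylinder (hp : p ∈ Icc (0 : ℝ) 1) (s : Finset E) (f : E → Bool) :
    perc E p {ω | ∀ e ∈ s, ω e = f e} = ∏ e ∈ s, ENNReal.ofReal (if f e then p else 1 - p) := by
  have := isProbabilityMeasure_bern hp
  have h : {ω : E → Bool | ∀ e ∈ s, ω e = f e} = Set.pi s fun e ↦ {f e} := by
    ext ω
    simp [Set.mem_pi]
  rw [h, perc, Measure.infinitePi_pi _ fun _ _ ↦ measurableSet_singleton _]
  exact Finset.prod_congr rfl fun e _ ↦ bern_singleton p (f e)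

lemma perc_forall_true (hp : p ∈ Icc (0 : ℝ) 1) (s : Finset E) :
    perc E p {ω | ∀ e ∈ s, ω e = true} = ENNReal.ofReal p ^ s.card := by
  rw [perc_cylinder hp s fun _ ↦ true]
  simp

lemma perc_forall_false (hp : p ∈ Icc (0 : ℝ) 1) (s : Finset E) :
    perc E p {ω | ∀ e ∈ s, ω e = false} = ENNReal.ofReal (1 - p) ^ s.card := by
  rw [perc_cylinder hp s fun _ ↦ false]
  simp

lemma measurableSet_forall_eq (s : Finset E) (b : Bool) :
    MeasurableSet {ω : E → Bool | ∀ e ∈ s, ω e = b} := by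
  have h : {ω : E → Bool | ∀ e ∈ s, ω e = b} = ⋂ e ∈ s, (fun ω ↦ ω e) ⁻¹' {b} := by
    ext ω
    simp
  rw [h]
  exact Finset.measurableSet_biInter s fun e _ ↦ measurable_pi_apply e (measurableSet_singleton b)

/-- Percolation is characterized by the probabilities that finitely many given edges are open. -/
lemma eq_perc (hp : p ∈ Icc (0 : ℝ) 1) {ν : Measure (E → Bool)} [IsProbabilityMeasure ν]
    (h : ∀ s : Finset E, ν {ω | ∀ e ∈ s, ω e = true} = ENNReal.ofReal p ^ s.card) :
    ν = perc E p := by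
  classical
  have := isProbabilityMeasure_perc (E := E) hp
  refine ext_of_generate_finite
    (range fun s : Finset E ↦ {ω : E → Bool | ∀ e ∈ s, ω e = true}) ?_ ?_ ?_ (by simp)
  · refine le_antisymm ?_ (MeasurableSpace.generateFrom_le ?_)
    · refine iSup_le fun e ↦ measurable_iff_comap_le.1 ?_
      refine @measurable_to_bool _ (MeasurableSpace.generateFrom _) _ ?_
      refine MeasurableSpace.measurableSet_generateFrom ⟨{e}, ?_⟩
      ext ω
      simp
    · rintro _ ⟨s, rfl⟩
      exact measurableSet_forall_eq s true
  · rintro _ ⟨s, rfl⟩ _ ⟨t, rfl⟩ _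
    refine ⟨s ∪ t, ?_⟩
    ext ω
    simp only [Finset.mem_union, mem_ofPred_eq, mem_inter_iff]
    exact ⟨fun h ↦ ⟨fun e he ↦ h e (Or.inl he), fun e he ↦ h e (Or.inr he)⟩,
      fun h e he ↦ he.elim (h.1 e) (h.2 e)⟩
  · rintro _ ⟨s, rfl⟩
    rw [h, perc_forall_true hp]

lemma measurePreserving_of_forall_true {Ω : Type*} [MeasurableSpace Ω] {μ : Measure Ω}
    [IsProbabilityMeasure μ] (hp : p ∈ Icc (0 : ℝ) 1) {T : Ω → E → Bool} (hT : Measurable T)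
    (h : ∀ s : Finset E, μ {x | ∀ e ∈ s, T x e = true} = ENNReal.ofReal p ^ s.card) :
    MeasurePreserving T μ (perc E p) := by
  have := Measure.isProbabilityMeasure_map (μ := μ) hT.aemeasurable
  refine ⟨hT, eq_perc hp fun s ↦ ?_⟩
  rw [Measure.map_apply hT (measurableSet_forall_eq s true)]
  exact h s

lemma measurePreserving_comp (hp : p ∈ Icc (0 : ℝ) 1) {g : E → E} (hg : Function.Injective g) :
    MeasurePreserving (fun (ω : E → Bool) e ↦ ω (g e)) (perc E p) (perc E p) := by
  classical
  have := isProbabilityMeasure_perc (E := E) hp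
  refine measurePreserving_of_forall_true hp (by fun_prop) fun s ↦ ?_
  rw [← Finset.card_image_of_injective s hg, ← perc_forall_true hp]
  congr 1
  ext ω
  simp

/-- Intersection of two configurations. -/
def thin (z : (E → Bool) × (E → Bool)) : E → Bool := fun e ↦ z.1 e && z.2 e

lemma measurable_thin : Measurable (thin (E := E)) := by
  refine measurable_pi_lambda _ fun e ↦ ?_
  exact (measurable_of_finite fun b : Bool × Bool ↦ b.1 && b.2).comp
    (f := fun z : (E → Bool) × (E → Bool) ↦ (z.1 e, z.2 e)) (by fun_prop)

lemma measurePreserving_thin (hp : p ∈ Icc (0 : ℝ) 1) (hq : q ∈ Icc (0 : ℝ) 1) :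
    MeasurePreserving thin ((perc E p).prod (perc E q)) (perc E (p * q)) := by
  have := isProbabilityMeasure_perc (E := E) hp
  have := isProbabilityMeasure_perc (E := E) hq
  refine measurePreserving_of_forall_true
    ⟨mul_nonneg hp.1 hq.1, mul_le_one₀ hp.2 hq.1 hq.2⟩ measurable_thin fun s ↦ ?_
  have h : {z : (E → Bool) × (E → Bool) | ∀ e ∈ s, thin z e = true} =
      {ω | ∀ e ∈ s, ω e = true} ×ˢ {ω | ∀ e ∈ s, ω e = true} := by
    ext z
    simp only [thin, Bool.and_eq_true, mem_ofPred_eq, mem_prod]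
    exact ⟨fun h ↦ ⟨fun e he ↦ (h e he).1, fun e he ↦ (h e he).2⟩,
      fun h e he ↦ ⟨h.1 e he, h.2 e he⟩⟩
  rw [h, Measure.prod_prod, perc_forall_true hp, perc_forall_true hq, ENNReal.ofReal_mul hp.1,
    mul_pow]

lemma measurable_mix (F : Finset E) :
    Measurable fun z : (E → Bool) × (E → Bool) ↦ mix F z.1 z.2 := by
  classical
  refine measurable_pi_lambda _ fun e ↦ ?_
  by_cases h : e ∈ F <;> simp only [mix, h, if_true, if_false] <;> fun_prop

lemma measurePreserving_mix (hp : p ∈ Icc (0 : ℝ) 1) (F : Finset E) :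
    MeasurePreserving (fun z : (E → Bool) × (E → Bool) ↦ mix F z.1 z.2)
      ((perc E p).prod (perc E p)) (perc E p) := by
  classical
  have := isProbabilityMeasure_perc (E := E) hp
  refine measurePreserving_of_forall_true hp (measurable_mix F) fun s ↦ ?_
  have h : {z : (E → Bool) × (E → Bool) | ∀ e ∈ s, mix F z.1 z.2 e = true} =
      {ω | ∀ e ∈ s \ F, ω e = true} ×ˢ {ω | ∀ e ∈ s ∩ F, ω e = true} := by
    ext z
    simp only [mix, mem_ofPred_eq, mem_prod, Finset.mem_sdiff, Finset.mem_inter]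
    refine ⟨fun h ↦ ⟨fun e he ↦ ?_, fun e he ↦ ?_⟩, fun h e he ↦ ?_⟩
    · simpa [he.2] using h e he.1
    · simpa [he.2] using h e he.1
    · by_cases heF : e ∈ F
      · simpa [heF] using h.2 e ⟨he, heF⟩
      · simpa [heF] using h.1 e ⟨he, heF⟩
  rw [h, Measure.prod_prod, perc_forall_true hp, perc_forall_true hp, ← pow_add,
    Finset.card_sdiff_add_card_inter]

/-- Almost sure events survive the closing of finitely many edges. -/
lemma ae_close (hp : p ∈ Icc (0 : ℝ) 1) (hp1 : p < 1) (F : Finset E) {A : (E → Bool) → Prop}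
    (hA : ∀ᵐ ω ∂perc E p, A ω) : ∀ᵐ ω ∂perc E p, A (mix F ω fun _ ↦ false) := by
  have := isProbabilityMeasure_perc (E := E) hp
  have h1 := Measure.ae_ae_of_ae_prod ((measurePreserving_mix hp F).quasiMeasurePreserving.ae hA)
  filter_upwards [h1] with ω hω
  have hpos : perc E p {ξ | ∀ e ∈ F, ξ e = false} ≠ 0 := by
    rw [perc_forall_false hp]
    exact pow_ne_zero _ (by simpa using hp1)
  obtain ⟨ξ, hξ, hAξ⟩ := ((frequently_ae_mem_iff.2 hpos).and_eventually hω).exists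
  convert hAξ using 1
  ext e
  by_cases he : e ∈ F
  · simp [mix, he, hξ e he]
  · simp [mix, he]

/-- Almost surely one of infinitely many finite edge sets, of bounded size and locally finite,
is closed. -/
lemma ae_exists_closed {ι : Type*} (hq : q ∈ Icc (0 : ℝ) 1) (hq1 : q < 1) {A : Set ι}
    (hA : A.Infinite) {st : ι → Finset E} {D : ℕ} (hD : ∀ c, (st c).card ≤ D)
    (hfin : ∀ F : Finset E, {c | ¬ Disjoint (st c) F}.Finite) :
    ∀ᵐ ω ∂perc E q, ∃ c ∈ A, ∀ e ∈ st c, ω e = false := by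
  classical
  have := isProbabilityMeasure_perc (E := E) hq
  set δ : ℝ≥0∞ := ENNReal.ofReal (1 - q) ^ D with hδ
  have hδ0 : δ ≠ 0 := pow_ne_zero _ (by simpa using hq1)
  have hstep : ∀ m : ℕ, ∃ (X : Set (E → Bool)) (F : Finset E), MeasurableSet X ∧
      {ω | ¬ ∃ c ∈ A, ∀ e ∈ st c, ω e = false} ⊆ X ∧
      (∀ ω ω' : E → Bool, (∀ e ∈ F, ω e = ω' e) → ω ∈ X → ω' ∈ X) ∧
      perc E q X ≤ (1 - δ) ^ m := by
    intro m
    induction m with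
    | zero => exact ⟨univ, ∅, MeasurableSet.univ, subset_univ _, fun _ _ _ _ ↦ trivial, by simp⟩
    | succ m ih =>
      obtain ⟨X, F, hX, hsub, hdep, hle⟩ := ih
      obtain ⟨c, hcA, hc⟩ := hA.exists_notMem_finite (hfin F)
      simp only [mem_ofPred_eq, not_not] at hc
      have hY := measurableSet_forall_eq (st c) false
      refine ⟨X ∩ {ω | ∀ e ∈ st c, ω e = false}ᶜ, F ∪ st c, hX.inter hY.compl, ?_, ?_, ?_⟩
      · exact fun ω hω ↦ ⟨hsub hω, fun h ↦ hω ⟨c, hcA, h⟩⟩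
      · rintro ω ω' h ⟨h1, h2⟩
        refine ⟨hdep ω ω' (fun e he ↦ h e (Finset.mem_union_left _ he)) h1, fun h' ↦ h2 ?_⟩
        intro e he
        rw [h e (Finset.mem_union_right _ he)]
        exact h' e he
      · rw [← (measurePreserving_mix hq (st c)).measure_preimage
          (hX.inter hY.compl).nullMeasurableSet]
        have hpre : (fun z : (E → Bool) × (E → Bool) ↦ mix (st c) z.1 z.2) ⁻¹'
            (X ∩ {ω | ∀ e ∈ st c, ω e = false}ᶜ) = X ×ˢ {ω | ∀ e ∈ st c, ω e = false}ᶜ := by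
          ext ⟨ω, ξ⟩
          have hF : ∀ e ∈ F, mix (st c) ω ξ e = ω e := by
            intro e he
            have : e ∉ st c := fun h ↦ Finset.disjoint_left.1 hc h he
            simp [mix, this]
          have hS : ∀ e ∈ st c, mix (st c) ω ξ e = ξ e := fun e he ↦ by simp [mix, he]
          have h1 : mix (st c) ω ξ ∈ X ↔ ω ∈ X :=
            ⟨hdep _ _ hF, hdep _ _ fun e he ↦ (hF e he).symm⟩
          have h2 : (∀ e ∈ st c, mix (st c) ω ξ e = false) ↔ ∀ e ∈ st c, ξ e = false :=
            forall₂_congr fun e he ↦ by rw [hS e he]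
          simp only [mem_preimage, mem_inter_iff, mem_compl_iff, mem_ofPred_eq, mem_prod, h1, h2]
        rw [hpre, Measure.prod_prod, prob_compl_eq_one_sub hY, perc_forall_false hq, pow_succ]
        refine mul_le_mul' hle (tsub_le_tsub_left ?_ 1)
        exact pow_le_pow_right_of_le_one' (by simpa using hq.1) (hD c)
  rw [ae_iff]
  refine le_antisymm ?_ zero_le
  refine ge_of_tendsto' (ENNReal.tendsto_pow_atTop_nhds_zero_of_lt_one
    (ENNReal.sub_lt_self ENNReal.one_ne_top one_ne_zero hδ0)) fun m ↦ ?_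
  obtain ⟨X, _, _, hsub, _, hle⟩ := hstep m
  exact (measure_mono hsub).trans hle

end Percolation

section Measurability

open SimpleGraph

variable {α : Type*} [MeasurableSpace α] {S : Fin d → Γ} {g h : α → Γ × Fin d → Bool}

lemma measurable_openGraph_adj [Countable Γ] (hg : Measurable g) (u v : Γ) :
    Measurable fun z ↦ (openGraph S (g z)).Adj u v := by
  simp only [openGraph_adj]
  refine measurable_const.and (Measurable.exists fun e ↦ Measurable.and ?_ measurable_const)
  exact measurableSet_setOfPred.1 (((measurable_pi_apply e).comp hg) (measurableSet_singleton true))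

lemma exists_walk_length_succ {V : Type*} {H : SimpleGraph V} {u v : V} {n : ℕ} :
    (∃ p : H.Walk u v, p.length = n + 1) ↔ ∃ w, H.Adj u w ∧ ∃ p : H.Walk w v, p.length = n := by
  constructor
  · rintro ⟨p, hp⟩
    cases p with
    | nil => simp at hp
    | cons h p => exact ⟨_, h, p, by simpa using hp⟩
  · rintro ⟨w, h, p, rfl⟩
    exact ⟨p.cons h, rfl⟩

lemma measurable_exists_walk [Countable Γ] (hg : Measurable g) (n : ℕ) (u v : Γ) :
    Measurable fun z ↦ ∃ p : (openGraph S (g z)).Walk u v, p.length = n := by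
  induction n generalizing u with
  | zero =>
    have : ∀ z, (∃ p : (openGraph S (g z)).Walk u v, p.length = 0) ↔ u = v :=
      fun z ↦ ⟨fun ⟨p, hp⟩ ↦ Walk.eq_of_length_eq_zero hp, by rintro rfl; exact ⟨Walk.nil, rfl⟩⟩
    simp only [this]
    exact measurable_const
  | succ n ih =>
    simp only [exists_walk_length_succ]
    exact Measurable.exists fun w ↦ (measurable_openGraph_adj hg u w).and (ih w)

lemma measurable_reachable [Countable Γ] (hg : Measurable g) (u v : Γ) :
    Measurable fun z ↦ (openGraph S (g z)).Reachable u v := by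
  have : ∀ z, (openGraph S (g z)).Reachable u v ↔
      ∃ n, ∃ p : (openGraph S (g z)).Walk u v, p.length = n :=
    fun z ↦ ⟨fun ⟨p⟩ ↦ ⟨_, p, rfl⟩, fun ⟨_, p, _⟩ ↦ ⟨p⟩⟩
  simp only [this]
  exact Measurable.exists fun n ↦ measurable_exists_walk hg n u v

lemma measurable_infComp [Countable Γ] (hg : Measurable g) (v : Γ) :
    Measurable fun z ↦ InfComp (openGraph S (g z)) v := by
  have : ∀ z, InfComp (openGraph S (g z)) v ↔
      ∀ F : Finset Γ, ∃ u, u ∉ F ∧ (openGraph S (g z)).Reachable v u := by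
    refine fun z ↦ ⟨fun h F ↦ ?_, fun h hfin ↦ ?_⟩
    · obtain ⟨u, hu, huF⟩ := h.exists_notMem_finset F
      exact ⟨u, huF, hu⟩
    · obtain ⟨u, huF, hu⟩ := h hfin.toFinset
      exact huF (hfin.mem_toFinset.2 hu)
  simp only [this]
  exact Measurable.forall fun F ↦ Measurable.exists fun u ↦
    measurable_const.and (measurable_reachable hg v u)

lemma measurableSet_uniqueEvent [Countable Γ] (S : Fin d → Γ) :
    MeasurableSet (UniqueEvent S) := by
  refine measurableSet_setOfPred.2 ?_
  have : ∀ ω, (∃! C : Set Γ, IsInfCluster S ω C) ↔ _ := fun ω ↦ mem_uniqueEvent_iff (ω := ω)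
  simp only [this]
  have hid : Measurable fun ω : Γ × Fin d → Bool ↦ ω := measurable_id
  exact (Measurable.exists fun v ↦ measurable_infComp hid v).and <|
    Measurable.forall fun u ↦ Measurable.forall fun v ↦ (measurable_infComp hid u).imp <|
      (measurable_infComp hid v).imp (measurable_reachable hid u v)

lemma measurable_nearest [Countable Γ] (hg : Measurable g) (hh : Measurable h) (v y : Γ) :
    Measurable fun z ↦ Nearest (openGraph S (g z)) (InfComp (openGraph S (h z))) v y := by
  unfold Nearest
  exact (measurable_infComp hh y).and <| Measurable.exists fun n ↦
    (measurable_exists_walk hg n v y).and <| Measurable.forall fun z ↦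
      (measurable_infComp hh z).imp <| Measurable.forall fun m ↦
        (measurable_exists_walk hg m v z).imp measurable_const

end Measurability

section MassTransport

open SimpleGraph

section Iso

variable {V W : Type*} {G : SimpleGraph V} {H : SimpleGraph W}

lemma exists_walk_iso_iff (e : G ≃g H) {u v : V} {n : ℕ} :
    (∃ p : H.Walk (e u) (e v), p.length = n) ↔ ∃ p : G.Walk u v, p.length = n := by
  constructor
  · rintro ⟨p, rfl⟩
    exact ⟨(p.map e.symm.toHom).copy (e.symm_apply_apply u) (e.symm_apply_apply v), by simp⟩
  · rintro ⟨p, rfl⟩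
    exact ⟨p.map e.toHom, by simp⟩

lemma infComp_iso_iff (e : G ≃g H) {v : V} : InfComp H (e v) ↔ InfComp G v := by
  have h : {u | G.Reachable v u} = e ⁻¹' {u | H.Reachable (e v) u} := by
    ext u
    exact e.reachable_iff.symm
  unfold InfComp
  rw [h]
  refine not_congr ⟨Finite.preimage e.injective.injOn, fun hf ↦ ?_⟩
  rw [← image_preimage_eq {u | H.Reachable (e v) u} e.surjective]
  exact hf.image e

lemma nearest_iso_iff (e : G ≃g H) {I : V → Prop} {J : W → Prop} (hIJ : ∀ y, J (e y) ↔ I y)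
    {v y : V} : Nearest H J (e v) (e y) ↔ Nearest G I v y := by
  unfold Nearest
  rw [hIJ]
  refine and_congr_right fun _ ↦ exists_congr fun n ↦
    and_congr (exists_walk_iso_iff e) ⟨fun h z hz m hm ↦ ?_, fun h z hz m hm ↦ ?_⟩
  · exact h (e z) ((hIJ z).2 hz) m ((exists_walk_iso_iff e).2 hm)
  · obtain ⟨z, rfl⟩ := e.surjective z
    exact h z ((hIJ z).1 hz) m ((exists_walk_iso_iff e).1 hm)

end Iso

variable {S : Fin d → Γ} {p q : ℝ}

/-- The translate of the configuration `ω` by `g`. -/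
def shift (g : Γ) (ω : Γ × Fin d → Bool) : Γ × Fin d → Bool := fun e ↦ ω (g * e.1, e.2)

lemma measurePreserving_shift (hp : p ∈ Icc (0 : ℝ) 1) (g : Γ) :
    MeasurePreserving (shift (d := d) g) (perc _ p) (perc _ p) :=
  measurePreserving_comp hp (g := fun e : Γ × Fin d ↦ (g * e.1, e.2)) fun a b h ↦ by
    simpa [Prod.ext_iff] using h

/-- Translation by `g` as an isomorphism of graphs of open edges. -/
def shiftIso (S : Fin d → Γ) (g : Γ) (ω : Γ × Fin d → Bool) :
    openGraph S (shift g ω) ≃g openGraph S ω where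
  toEquiv := Equiv.mulLeft g
  map_rel_iff' {u v} := by
    simp only [openGraph_adj, Equiv.coe_mulLeft, ne_eq, mul_right_inj]
    refine and_congr_right fun _ ↦ ⟨?_, ?_⟩
    · rintro ⟨⟨a, i⟩, ha, hj⟩
      refine ⟨(g⁻¹ * a, i), by simpa [shift] using ha, ?_⟩
      simpa [Joins, eq_inv_mul_iff_mul_eq, mul_assoc] using hj
    · rintro ⟨⟨a, i⟩, ha, hj⟩
      exact ⟨(g * a, i), ha, by simpa [Joins, mul_assoc] using hj⟩

/-- A translation-equivariant choice of a vertex `y` nearest to `v` in the infinite clusters of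
the thinned configuration, with distances measured in the original one. -/
def SelNearest [Encodable Γ] (S : Fin d → Γ) (z : (Γ × Fin d → Bool) × (Γ × Fin d → Bool))
    (v y : Γ) : Prop :=
  Nearest (openGraph S z.1) (InfComp (openGraph S (thin z))) v y ∧
    ∀ y', Nearest (openGraph S z.1) (InfComp (openGraph S (thin z))) v y' →
      Encodable.encode (v⁻¹ * y) ≤ Encodable.encode (v⁻¹ * y')

variable [Encodable Γ]

lemma SelNearest.unique {z : (Γ × Fin d → Bool) × (Γ × Fin d → Bool)} {v y y' : Γ}
    (h : SelNearest S z v y) (h' : SelNearest S z v y') : y = y' :=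
  mul_left_cancel <| Encodable.encode_injective <| le_antisymm (h.2 y' h'.1) (h'.2 y h.1)

lemma exists_selNearest {z : (Γ × Fin d → Bool) × (Γ × Fin d → Bool)} {v : Γ}
    (h : ∃ y, Nearest (openGraph S z.1) (InfComp (openGraph S (thin z))) v y) :
    ∃ y, SelNearest S z v y := by
  obtain ⟨y, hy, hmin⟩ := exists_minimalFor_of_wellFoundedLT _
    (fun y ↦ Encodable.encode (v⁻¹ * y)) h
  exact ⟨y, hy, fun y' hy' ↦ (le_total _ _).elim id (hmin hy')⟩

lemma selNearest_shift (g : Γ) {z : (Γ × Fin d → Bool) × (Γ × Fin d → Bool)} {v y : Γ} :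
    SelNearest S (Prod.map (shift g) (shift g) z) v y ↔ SelNearest S z (g * v) (g * y) := by
  have key : ∀ y, Nearest (openGraph S z.1) (InfComp (openGraph S (thin z))) (g * v) (g * y) ↔
      Nearest (openGraph S (shift g z.1))
        (InfComp (openGraph S (thin (Prod.map (shift g) (shift g) z)))) v y := fun y ↦
    nearest_iso_iff (shiftIso S g z.1) fun y ↦ infComp_iso_iff (shiftIso S g (thin z))
  unfold SelNearest
  rw [key]
  refine and_congr_right fun _ ↦ ⟨fun h y' hy' ↦ ?_, fun h y' hy' ↦ ?_⟩
  · have := h (g⁻¹ * y') ((key _).1 (by simpa using hy'))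
    simpa [mul_assoc] using this
  · have := h (g * y') ((key _).2 hy')
    simpa [mul_assoc] using this

lemma measurable_selNearest (S : Fin d → Γ) (v y : Γ) : Measurable fun z ↦ SelNearest S z v y := by
  unfold SelNearest
  exact (measurable_nearest measurable_fst measurable_thin v y).and <| Measurable.forall fun y' ↦
    (measurable_nearest measurable_fst measurable_thin v y').imp measurable_const

lemma ae_finite_selNearest (S : Fin d → Γ) (hp : p ∈ Icc (0 : ℝ) 1) (hq : q ∈ Icc (0 : ℝ) 1) :
    ∀ᵐ z ∂(perc (Γ × Fin d) p).prod (perc (Γ × Fin d) q),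
      ∀ y, {v | SelNearest S z v y}.Finite := by
  have := isProbabilityMeasure_perc (E := Γ × Fin d) hp
  have := isProbabilityMeasure_perc (E := Γ × Fin d) hq
  have hmeas : ∀ v y, MeasurableSet {z | SelNearest S z v y} := fun v y ↦
    measurableSet_setOfPred.2 (measurable_selNearest S v y)
  rw [ae_all_iff]
  intro y
  have hinv : ∀ v, (perc (Γ × Fin d) p).prod (perc (Γ × Fin d) q) {z | SelNearest S z v y} =
      (perc (Γ × Fin d) p).prod (perc (Γ × Fin d) q) {z | SelNearest S z 1 (v⁻¹ * y)} := by
    intro v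
    rw [← ((measurePreserving_shift hp v).prod
      (measurePreserving_shift hq v)).measure_preimage (hmeas 1 _).nullMeasurableSet]
    congr 1
    ext z
    exact ((selNearest_shift v).trans (by simp)).symm
  have hsum := ((Equiv.inv Γ).trans (Equiv.mulRight y)).tsum_eq fun x ↦
    (perc (Γ × Fin d) p).prod (perc (Γ × Fin d) q) {z | SelNearest S z 1 x}
  simp only [Equiv.trans_apply, Equiv.inv_apply, Equiv.coe_mulRight] at hsum
  refine ae_finite_setOfPred_mem (s := fun v ↦ {z | SelNearest S z v y}) ?_
  rw [tsum_congr hinv, hsum, ← measure_iUnion _ fun x ↦ hmeas 1 x]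
  · exact measure_ne_top _ _
  · exact fun x x' hne ↦ disjoint_left.2 fun z hz hz' ↦ hne (SelNearest.unique hz hz')

end MassTransport

section CycleCounting

open SimpleGraph

open scoped ENNReal

variable {S : Fin d → Γ} {p : ℝ}

lemma Joins.determined {S : Fin d → Γ} {e e' : Γ × Fin d} {u v v' : Γ} (h : Joins S e u v)
    (h' : Joins S e' u v') (h2 : e.2 = e'.2) (h1 : u = e.1 ↔ u = e'.1) : e = e' ∧ v = v' := by
  obtain ⟨a, i⟩ := e
  obtain ⟨b, j⟩ := e'
  obtain rfl : i = j := h2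
  simp only [Joins] at h h' h1
  by_cases hu : u = a
  · have hb := h1.1 hu
    subst hu
    subst hb
    have hv : ∀ w, (u = u ∧ w = u * S i ∨ w = u ∧ u = u * S i) → w = u * S i :=
      fun w hw ↦ hw.elim And.right fun hw ↦ hw.1.trans hw.2
    exact ⟨rfl, (hv v h).trans (hv v' h').symm⟩
  · have hb : ¬ u = b := fun h ↦ hu (h1.2 h)
    obtain ⟨rfl, h⟩ := h.resolve_left fun h ↦ hu h.1
    obtain ⟨rfl, h'⟩ := h'.resolve_left fun h ↦ hb h.1
    obtain rfl := mul_right_cancel (h.symm.trans h')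
    exact ⟨rfl, rfl⟩

instance finite_cycles (S : Fin d → Γ) (n : ℕ) :
    Finite {w : (Fin n → Γ × Fin d) × (Fin (n + 1) → Γ) // IsCycle S n w.1 w.2 ∧ w.2 0 = 1} := by
  classical
  refine Finite.of_injective (β := Fin n → Fin d × Bool)
    (fun w k ↦ ((w.1.1 k).2, decide (w.1.2 k.castSucc = (w.1.1 k).1))) ?_
  rintro ⟨⟨ed, vs⟩, hc, h0⟩ ⟨⟨ed', vs'⟩, hc', h0'⟩ h
  dsimp only at hc hc' h0 h0' h
  have hJ := hc.2.2.1
  have hJ' := hc'.2.2.1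
  simp only [funext_iff, Prod.mk.injEq, decide_eq_decide] at h
  have hvs : ∀ k, vs k = vs' k := by
    intro k
    induction k using Fin.induction with
    | zero => rw [h0, h0']
    | succ k ih =>
      have h1 := hJ k
      have h2 := (h k).2
      rw [ih] at h1 h2
      exact (h1.determined (hJ' k) (h k).1 h2).2
  have hed : ∀ k, ed k = ed' k := by
    intro k
    have h1 := hJ k
    have h2 := (h k).2
    rw [hvs k.castSucc] at h1 h2
    exact (h1.determined (hJ' k) (h k).1 h2).1
  simp only [Subtype.mk.injEq, Prod.mk.injEq]
  exact ⟨funext hed, funext hvs⟩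

/-- There is an open simple cycle of length `n` through `1`. -/
def openCycleEvent (S : Fin d → Γ) (n : ℕ) : Set (Γ × Fin d → Bool) :=
  {ω | ∃ ed vs, IsCycle S n ed vs ∧ vs 0 = 1 ∧ ∀ k, ω (ed k) = true}

lemma perc_openCycleEvent_le (hp : p ∈ Icc (0 : ℝ) 1) (n : ℕ) :
    perc _ p (openCycleEvent S n) ≤ ENNReal.ofReal (cycleCount S n * p ^ n) := by
  classical
  have hsub : openCycleEvent S n ⊆ ⋃ w : {w : (Fin n → Γ × Fin d) × (Fin (n + 1) → Γ) //
      IsCycle S n w.1 w.2 ∧ w.2 0 = 1},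
        {ω | ∀ e ∈ Finset.univ.image w.1.1, ω e = true} := by
    rintro ω ⟨ed, vs, hc, h0, hω⟩
    exact mem_iUnion.2 ⟨⟨(ed, vs), hc, h0⟩, by simpa using hω⟩
  refine (measure_mono hsub).trans ((measure_iUnion_le _).trans ?_)
  have hcard : ∀ w : {w : (Fin n → Γ × Fin d) × (Fin (n + 1) → Γ) //
      IsCycle S n w.1 w.2 ∧ w.2 0 = 1},
        perc _ p {ω | ∀ e ∈ Finset.univ.image w.1.1, ω e = true} = ENNReal.ofReal p ^ n := by
    intro w
    rw [perc_forall_true hp, Finset.card_image_of_injective _ w.2.1.2.2.2.2, Finset.card_fin]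
  have := Fintype.ofFinite {w : (Fin n → Γ × Fin d) × (Fin (n + 1) → Γ) //
    IsCycle S n w.1 w.2 ∧ w.2 0 = 1}
  rw [tsum_congr hcard, tsum_fintype, Finset.sum_const, Finset.card_univ, nsmul_eq_mul,
    ENNReal.ofReal_mul (Nat.cast_nonneg _), ENNReal.ofReal_natCast, ENNReal.ofReal_pow hp.1,
    cycleCount, Nat.card_eq_fintype_card]

lemma isBoundedUnder_of_gammaExp_ne_zero (h : gammaExp S ≠ 0) :
    Filter.IsBoundedUnder (· ≤ ·) Filter.atTop
      fun n : ℕ ↦ (cycleCount S n : ℝ) ^ ((n : ℝ)⁻¹) := by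
  by_contra hb
  apply h
  have : {a : ℝ | ∀ᶠ n : ℕ in Filter.atTop, (cycleCount S n : ℝ) ^ ((n : ℝ)⁻¹) ≤ a} = ∅ :=
    eq_empty_of_forall_notMem fun a ha ↦ hb ⟨a, Filter.eventually_map.2 ha⟩
  rw [gammaExp, Filter.limsup_eq, this, Real.sInf_empty]

lemma summable_cycleCount_mul_pow (hp : p ∈ Icc (0 : ℝ) 1) (h0 : gammaExp S ≠ 0)
    (h : p * gammaExp S < 1) : Summable fun n ↦ (cycleCount S n : ℝ) * p ^ n := by
  set r := gammaExp S + (1 - p * gammaExp S) / 2 with hr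
  have hev : ∀ᶠ n : ℕ in Filter.atTop, (cycleCount S n : ℝ) ^ ((n : ℝ)⁻¹) < r :=
    Filter.eventually_lt_of_limsup_lt (by rw [← gammaExp]; linarith)
      (isBoundedUnder_of_gammaExp_ne_zero h0)
  have hr0 : 0 ≤ r := by
    obtain ⟨n, hn⟩ := hev.exists
    exact (Real.rpow_nonneg (Nat.cast_nonneg _) _).trans hn.le
  have hpr : p * r < 1 := by
    rw [hr]
    nlinarith [hp.2]
  refine Summable.of_norm_bounded_eventually_nat
    (summable_geometric_of_lt_one (mul_nonneg hp.1 hr0) hpr) ?_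
  filter_upwards [hev, Filter.eventually_ne_atTop 0] with n hn hn0
  rw [Real.norm_of_nonneg (mul_nonneg (Nat.cast_nonneg _) (pow_nonneg hp.1 _)), mul_pow, mul_comm]
  refine mul_le_mul_of_nonneg_left ?_ (pow_nonneg hp.1 _)
  rw [← Real.rpow_inv_natCast_pow (Nat.cast_nonneg (cycleCount S n)) hn0]
  exact pow_le_pow_left₀ (Real.rpow_nonneg (Nat.cast_nonneg _) _) hn.le n

lemma ae_bounded_cycles [Countable Γ] (hp : p ∈ Icc (0 : ℝ) 1) (h0 : gammaExp S ≠ 0)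
    (h : p * gammaExp S < 1) :
    ∀ᵐ ω ∂perc (Γ × Fin d) p, ∀ v, ∃ L, ∀ C : (openGraph S ω).Walk v v,
      C.IsCycle → C.length ≤ L := by
  have hfin : ∀ᵐ ω ∂perc (Γ × Fin d) p, {n | ω ∈ openCycleEvent S n}.Finite := by
    refine ae_finite_setOfPred_mem (ne_top_of_le_ne_top ?_
      (ENNReal.tsum_le_tsum fun n ↦ perc_openCycleEvent_le hp n))
    exact (summable_cycleCount_mul_pow hp h0 h).tsum_ofReal_ne_top
  rw [ae_all_iff]
  intro v
  filter_upwards [(measurePreserving_shift hp v).quasiMeasurePreserving.ae hfin] with ω hω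
  obtain ⟨L, hL⟩ := hω.bddAbove
  refine ⟨L, fun C hC ↦ hL ?_⟩
  obtain ⟨ed, vs, h1, h2, h3⟩ := exists_isCycle_of_walk
    (hC.map (f := (shiftIso S v ω).symm.toHom) (shiftIso S v ω).symm.injective)
  rw [← Walk.length_map (shiftIso S v ω).symm.toHom C]
  exact ⟨ed, vs, h1, h2.trans (inv_mul_cancel v), h3⟩

end CycleCounting

section Uniqueness

open SimpleGraph

variable {S : Fin d → Γ} {p q : ℝ}

lemma countable_of_closure_eq_top (hgen : Subgroup.closure (range S) = ⊤) : Countable Γ := by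
  have : Countable (FreeGroup (Fin d)) := inferInstanceAs (Countable (Quot _))
  exact (FreeGroup.lift_surjective_iff_closure_range_eq_top.2 hgen).countable

lemma reachable_of_forall_open (hgen : Subgroup.closure (range S) = ⊤)
    {ω : Γ × Fin d → Bool} (hω : ∀ e, ω e = true) (u v : Γ) : (openGraph S ω).Reachable u v := by
  have h : ∀ g ∈ Subgroup.closure (range S), ∀ u, (openGraph S ω).Reachable u (u * g) := by
    intro g hg
    induction hg using Subgroup.closure_induction with
    | mem g hg =>
      obtain ⟨i, rfl⟩ := hg
      exact fun u ↦ openConn_iff_reachable.1 <|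
        Relation.ReflTransGen.single ⟨(u, i), hω _, Or.inl ⟨rfl, rfl⟩⟩
    | one => simp
    | mul a b _ _ ha hb => exact fun u ↦ mul_assoc u a b ▸ (ha u).trans (hb (u * a))
    | inv a _ ha => exact fun u ↦ by simpa using (ha (u * a⁻¹)).symm
  simpa using h (u⁻¹ * v) (hgen ▸ Subgroup.mem_top _) u

lemma isBernoulli_one_uniqueEvent [Infinite Γ] (hgen : Subgroup.closure (range S) = ⊤)
    {P : Measure (Γ × Fin d → Bool)} (hP : IsBernoulli S 1 P) : P (UniqueEvent S) = 1 := by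
  have := countable_of_closure_eq_top hgen
  have := hP.1
  have hae : ∀ᵐ ω ∂P, ∀ e, ω e = true := by
    rw [ae_all_iff]
    intro e
    have h := hP.2 {e} fun _ ↦ true
    rw [ae_iff]
    have hm : MeasurableSet {ω : Γ × Fin d → Bool | ω e = true} := by
      simpa using measurableSet_forall_eq {e} true
    exact (prob_compl_eq_zero_iff hm).2 (by simpa using h)
  rw [← prob_compl_eq_zero_iff (measurableSet_uniqueEvent S), ← mem_ae_iff]
  filter_upwards [hae] with ω hω
  have hr := reachable_of_forall_open hgen hω
  refine mem_uniqueEvent_iff.2 ⟨⟨1, ?_⟩, fun u v _ _ ↦ hr u v⟩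
  have : {u | (openGraph S ω).Reachable 1 u} = univ := eq_univ_of_forall (hr 1)
  rw [InfComp, this]
  exact infinite_univ

lemma one_le_gammaExp (h0 : gammaExp S ≠ 0) : 1 ≤ gammaExp S := by
  by_contra! h
  apply h0
  have hev : ∀ᶠ n : ℕ in Filter.atTop, (cycleCount S n : ℝ) ^ ((n : ℝ)⁻¹) = 0 := by
    filter_upwards [Filter.eventually_lt_of_limsup_lt h (isBoundedUnder_of_gammaExp_ne_zero h0),
      Filter.eventually_ne_atTop 0] with n hn hn0
    rcases Nat.eq_zero_or_pos (cycleCount S n) with hc | hc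
    · rw [hc, Nat.cast_zero, Real.zero_rpow (inv_ne_zero (Nat.cast_ne_zero.2 hn0))]
    · exact absurd hn (not_lt.2 (Real.one_le_rpow (Nat.one_le_cast.2 hc)
        (inv_nonneg.2 (Nat.cast_nonneg n))))
  rw [gammaExp, Filter.limsup_congr hev, Filter.limsup_const]

/-- If the cycle growth rate is below `1 / p` and the thinned configuration
a.s. has a unique infinite cluster, then infinitely many vertices cut off the vertex `o` in the
original configuration. -/
lemma ae_infinite_cut_vertices [Countable Γ] (hp : p ∈ Icc (0 : ℝ) 1) (hq : q ∈ Icc (0 : ℝ) 1)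
    (hpq : p * q < 1) (h0 : gammaExp S ≠ 0) (hγ : p * gammaExp S < 1)
    (huniq : ∀ᵐ ω ∂perc (Γ × Fin d) (p * q), ω ∈ UniqueEvent S) :
    ∀ᵐ z ∂(perc (Γ × Fin d) p).prod (perc (Γ × Fin d) q), ∀ o,
      InfComp (openGraph S (thin z)) o →
        {c | {u | ((openGraph S z.1).deleteIncidenceSet c).Reachable o u}.Finite}.Infinite := by
  have := Encodable.ofCountable Γ
  have := isProbabilityMeasure_perc (E := Γ × Fin d) hp
  have := isProbabilityMeasure_perc (E := Γ × Fin d) hq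
  have hpq' : p * q ∈ Icc (0 : ℝ) 1 := ⟨mul_nonneg hp.1 hq.1, hpq.le⟩
  have hdel : ∀ᵐ ω ∂perc (Γ × Fin d) (p * q), ∀ c,
      mix (edgeStar S c) ω (fun _ ↦ false) ∈ UniqueEvent S :=
    ae_all_iff.2 fun c ↦ ae_close hpq' hpq _ huniq
  have hthin := (measurePreserving_thin (E := Γ × Fin d) hp hq).quasiMeasurePreserving
  have hfst := (measurePreserving_fst (μ := perc (Γ × Fin d) p)
    (ν := perc (Γ × Fin d) q)).quasiMeasurePreserving
  filter_upwards [hthin.ae huniq, hthin.ae hdel, hfst.ae (ae_bounded_cycles hp h0 hγ),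
    ae_finite_selNearest S hp hq] with z h1 h2 h3 h4 o ho
  refine infinite_cut_vertices (openGraph_mono fun e he ↦ ?_) (finite_setOf_openGraph_adj S z.1) h3
    (mem_uniqueEvent_iff.1 h1).2 (fun c ↦ ?_) (φ := SelNearest S z) (fun _ _ h ↦ h.1)
    (fun _ ↦ exists_selNearest) h4 ho
  · exact (Bool.and_eq_true_iff.1 he).1
  · rw [← openGraph_mix_edgeStar]
    exact (mem_uniqueEvent_iff.1 (h2 c)).2

lemma not_ae_uniqueEvent [Countable Γ] (hp : p ∈ Icc (0 : ℝ) 1) (hq : q ∈ Icc (0 : ℝ) 1)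
    (hq1 : q < 1) (h0 : gammaExp S ≠ 0) (hγ : p * gammaExp S < 1) :
    ¬ ∀ᵐ ω ∂perc (Γ × Fin d) (p * q), ω ∈ UniqueEvent S := by
  intro huniq
  have := isProbabilityMeasure_perc (E := Γ × Fin d) hp
  have := isProbabilityMeasure_perc (E := Γ × Fin d) hq
  have hpq : p * q < 1 := (mul_le_of_le_one_left hq.1 hp.2).trans_lt hq1
  have hcut := Measure.ae_ae_of_ae_prod (ae_infinite_cut_vertices hp hq hpq h0 hγ huniq)
  have hnone : ∀ᵐ z ∂(perc (Γ × Fin d) p).prod (perc (Γ × Fin d) q), ∀ o,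
      ¬ InfComp (openGraph S (thin z)) o := by
    refine ae_all_iff.2 fun o ↦ (Measure.ae_prod_iff_ae_ae (measurableSet_setOfPred.2
      (measurable_infComp measurable_thin o).not)).2 ?_
    filter_upwards [hcut] with ω hω
    by_cases hA : {c | {u | ((openGraph S ω).deleteIncidenceSet c).Reachable o u}.Finite}.Infinite
    · filter_upwards [ae_exists_closed hq hq1 hA (card_edgeStar_le S)
        (finite_setOf_not_disjoint_edgeStar S)] with η ⟨c, hc, hη⟩ hinf
      have hle : openGraph S (thin (ω, η)) ≤ (openGraph S ω).deleteIncidenceSet c := by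
        rw [← openGraph_mix_edgeStar]
        refine openGraph_mono fun e he ↦ ?_
        obtain ⟨h1, h2⟩ := Bool.and_eq_true_iff.1 he
        have : e ∉ edgeStar S c := fun h ↦ by simp [hη e h] at h2
        simpa [mix, this] using h1
      exact hinf (Finite.subset hc fun u hu ↦ hu.mono hle)
    · filter_upwards [hω] with η hη hinf
      exact hA (hη o hinf)
  obtain ⟨z, hz, hz'⟩ := (hnone.and
    ((measurePreserving_thin hp hq).quasiMeasurePreserving.ae huniq)).exists
  obtain ⟨v, hv⟩ := (mem_uniqueEvent_iff.1 hz').1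
  exact hz v hv

end Uniqueness

/-- Schramm's lower bound for `p_u`: for a Cayley graph `G = Cay(Γ, S)` of an infinite
finitely generated group, `1/γ(G) ≤ p_u(G)`. -/
theorem one_div_gamma_le_pu (Γ : Type) [Group Γ] [Infinite Γ] (d : ℕ) (S : Fin d → Γ)
    (hgen : Subgroup.closure (Set.range S) = ⊤) :
    1 / gammaExp S ≤ pu S := by
  refine le_csInf ⟨1, ⟨zero_le_one, le_rfl⟩, fun P hP ↦ isBernoulli_one_uniqueEvent hgen hP⟩ ?_
  rintro p ⟨hp, hP⟩
  by_cases h0 : gammaExp S = 0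
  · simpa [h0] using hp.1
  have hγ1 := one_le_gammaExp h0
  have hγpos : 0 < gammaExp S := one_pos.trans_le hγ1
  by_contra! hlt
  have := countable_of_closure_eq_top hgen
  obtain ⟨p', hpp', hp'γ⟩ := exists_between hlt
  have hp'0 : 0 < p' := hp.1.trans_lt hpp'
  have hp' : p' ∈ Icc (0 : ℝ) 1 :=
    ⟨hp'0.le, hp'γ.le.trans ((div_le_one hγpos).2 hγ1)⟩
  have hq1 : p / p' < 1 := (div_lt_one hp'0).2 hpp'
  have := isProbabilityMeasure_perc (E := Γ × Fin d) hp
  refine not_ae_uniqueEvent hp' ⟨div_nonneg hp.1 hp'0.le, hq1.le⟩ hq1 h0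
    ((lt_div_iff₀ hγpos).1 hp'γ) ?_
  rw [mul_div_cancel₀ p hp'0.ne']
  exact mem_ae_iff.2 ((prob_compl_eq_zero_iff (measurableSet_uniqueEvent S)).2
    (hP _ ⟨this, perc_cylinder hp⟩))

end
end

section
/- Let Γ be an infinite group generated by a finite generating family S = (s_1, …, s_d) and let G = Cay(Γ, S). If ρ(G) ≤ 1/2, then p_c(G) < p_u(G). -/
open MeasureTheory Set

noncomputable section

variable {Γ : Type} [Group Γ] {d : ℕ}

/-- The event that there is an infinite cluster. -/
def PercEvent (S : Fin d → Γ) : Set (Γ × Fin d → Bool) :=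
  {ω | ∃ v, (Cluster S ω v).Infinite}

/-- The critical probability `p_c(Cay(Γ, S))`. -/
def pc (S : Fin d → Γ) : ℝ :=
  sInf {p | p ∈ Icc (0:ℝ) 1 ∧
    ∀ P : Measure (Γ × Fin d → Bool), IsBernoulli S p P → P (PercEvent S) = 1}

/-- The `ℓ²`-norm of a function `f : Γ → ℝ` (junk value if not square-summable). -/
def l2norm (f : Γ → ℝ) : ℝ := Real.sqrt (∑' g, f g ^ 2)

/-- The simple random walk operator: `(P f)(g) = (1/d) ∑ i, f (g * S i)`. -/
def rwOp (S : Fin d → Γ) (f : Γ → ℝ) : Γ → ℝ := fun g => (∑ i, f (g * S i)) / d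

/-- The spectral radius `ρ(Cay(Γ, S))`: the operator norm of the simple random walk operator
on `ℓ²(Γ)` (by density it suffices to test finitely supported functions). -/
def specRad (S : Fin d → Γ) : ℝ :=
  sInf {c | 0 ≤ c ∧ ∀ f : Γ →₀ ℝ, l2norm (rwOp S ⇑f) ≤ c * l2norm ⇑f}

/-! ### Bernoulli measures -/

theorem measurableSet_cylinder (s : Finset (Γ × Fin d)) (f : Γ × Fin d → Bool) :
    MeasurableSet {ω : Γ × Fin d → Bool | ∀ e ∈ s, ω e = f e} := by
  have : {ω : Γ × Fin d → Bool | ∀ e ∈ s, ω e = f e} = ⋂ e ∈ s, {ω | ω e = f e} := by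
    ext; simp
  rw [this]
  refine s.measurableSet_biInter fun e _ => ?_
  exact measurableSet_eq_fun (measurable_pi_apply e) measurable_const

/-- A measure is determined by the cylinder probabilities of Bernoulli percolation. -/
theorem IsBernoulli.ext {S : Fin d → Γ} {p : ℝ} {P Q : Measure (Γ × Fin d → Bool)}
    (hP : IsBernoulli S p P) (hQ : IsBernoulli S p Q) : P = Q := by
  classical
  have := hP.1
  have := hQ.1
  refine ext_of_generate_finite
    {A | ∃ (s : Finset (Γ × Fin d)) (f : Γ × Fin d → Bool), A = {ω | ∀ e ∈ s, ω e = f e}}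
    (le_antisymm ?_ ?_) ?_ ?_ (by simp)
  · refine iSup_le fun e => ?_
    rw [← measurable_iff_comap_le]
    refine @measurable_to_bool _ (_) _ (MeasurableSpace.measurableSet_generateFrom ?_)
    exact ⟨{e}, fun _ => true, by ext; simp⟩
  · refine MeasurableSpace.generateFrom_le ?_
    rintro _ ⟨s, f, rfl⟩
    exact measurableSet_cylinder s f
  · rintro _ ⟨s, f, rfl⟩ _ ⟨t, g, rfl⟩ ⟨η, hs, ht⟩
    refine ⟨s ∪ t, η, ?_⟩
    ext ω
    simp only [mem_inter_iff, mem_ofPred_eq, Finset.mem_union]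
    constructor
    · rintro ⟨h1, h2⟩ e (he | he)
      · rw [h1 e he, hs e he]
      · rw [h2 e he, ht e he]
    · intro h
      exact ⟨fun e he => by rw [h e (.inl he), hs e he], fun e he => by rw [h e (.inr he), ht e he]⟩
  · rintro _ ⟨s, f, rfl⟩
    rw [hP.2, hQ.2]

/-- Bernoulli percolation exists. -/
theorem exists_isBernoulli (S : Fin d → Γ) {p : ℝ} (hp : p ∈ Icc (0 : ℝ) 1) :
    ∃ P, IsBernoulli S p P := by
  classical
  let ν : Measure Bool :=
    ENNReal.ofReal p • Measure.dirac true + ENNReal.ofReal (1 - p) • Measure.dirac false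
  have hν : IsProbabilityMeasure ν := ⟨by
    simp only [ν, Measure.add_apply, Measure.smul_apply, measure_univ, smul_eq_mul, mul_one]
    rw [← ENNReal.ofReal_add hp.1 (by linarith [hp.2])]
    simp⟩
  refine ⟨Measure.infinitePi fun _ => ν, inferInstance, fun s f => ?_⟩
  have : {ω : Γ × Fin d → Bool | ∀ e ∈ s, ω e = f e} = Set.pi s fun e => {f e} := by
    ext; simp
  rw [this, Measure.infinitePi_pi _ fun e _ => measurableSet_singleton _]
  refine Finset.prod_congr rfl fun e _ => ?_
  cases f e <;> simp [ν]

/-- Resampling one edge does not change the law. -/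
theorem IsBernoulli.eq_resample {S : Fin d → Γ} {p : ℝ} {P : Measure (Γ × Fin d → Bool)}
    (hP : IsBernoulli S p P) (hp : p ∈ Icc (0 : ℝ) 1) [DecidableEq (Γ × Fin d)] (e : Γ × Fin d) :
    P = ENNReal.ofReal p • P.map (fun ω => Function.update ω e true) +
      ENNReal.ofReal (1 - p) • P.map (fun ω => Function.update ω e false) := by
  have := hP.1
  have hsum : ENNReal.ofReal p + ENNReal.ofReal (1 - p) = 1 := by
    rw [← ENNReal.ofReal_add hp.1 (by linarith [hp.2])]
    simp
  have hm : ∀ b : Bool, Measurable fun ω : Γ × Fin d → Bool => Function.update ω e b :=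
    fun b => measurable_update_left
  refine hP.ext ⟨⟨?_⟩, fun s f => ?_⟩
  · simp only [Measure.add_apply, Measure.smul_apply, smul_eq_mul]
    rw [Measure.map_apply (hm _) .univ, Measure.map_apply (hm _) .univ]
    simpa using hsum
  · simp only [Measure.add_apply, Measure.smul_apply, smul_eq_mul]
    rw [Measure.map_apply (hm _) (measurableSet_cylinder s f),
      Measure.map_apply (hm _) (measurableSet_cylinder s f)]
    by_cases he : e ∈ s
    · have key : ∀ b : Bool, P ((fun ω => Function.update ω e b) ⁻¹' {ω | ∀ e ∈ s, ω e = f e}) =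
          if b = f e then ∏ x ∈ s.erase e, ENNReal.ofReal (if f x then p else 1 - p) else 0 := by
        intro b
        split_ifs with hb
        · rw [← hP.2]
          congr 1
          ext ω
          simp only [mem_preimage, mem_ofPred_eq, Finset.mem_erase]
          constructor
          · intro h x hx
            rw [← h x hx.2, Function.update_of_ne hx.1]
          · intro h x hx
            by_cases hxe : x = e
            · subst hxe; simpa using hb
            · rw [Function.update_of_ne hxe, h x ⟨hxe, hx⟩]
        · convert measure_empty (μ := P)
          ext ω
          simp only [mem_preimage, mem_ofPred_eq, mem_empty_iff_false, iff_false]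
          intro h
          exact hb (by simpa using h e he)
      rw [key, key, ← Finset.mul_prod_erase s _ he]
      cases f e <;> simp
    · have key : ∀ b : Bool, P ((fun ω => Function.update ω e b) ⁻¹' {ω | ∀ e ∈ s, ω e = f e}) =
          ∏ x ∈ s, ENNReal.ofReal (if f x then p else 1 - p) := by
        intro b
        rw [← hP.2]
        congr 1
        ext ω
        simp only [mem_preimage, mem_ofPred_eq]
        refine forall₂_congr fun x hx => ?_
        rw [Function.update_of_ne (by rintro rfl; exact he hx)]
      rw [key, key, ← add_mul, hsum, one_mul]

/-- Translation of configurations. -/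
def shiftConfig (g : Γ) (ω : Γ × Fin d → Bool) : Γ × Fin d → Bool := fun e => ω (g * e.1, e.2)

theorem measurable_shiftConfig (g : Γ) :
    Measurable (shiftConfig g : (Γ × Fin d → Bool) → Γ × Fin d → Bool) :=
  measurable_pi_lambda _ fun e => measurable_pi_apply (g * e.1, e.2)

/-- Bernoulli percolation is translation invariant. -/
theorem IsBernoulli.map_shiftConfig {S : Fin d → Γ} {p : ℝ} {P : Measure (Γ × Fin d → Bool)}
    (hP : IsBernoulli S p P) (g : Γ) : P.map (shiftConfig g) = P := by
  have := hP.1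
  refine IsBernoulli.ext (S := S) (p := p)
    ⟨Measure.isProbabilityMeasure_map (measurable_shiftConfig g).aemeasurable, fun s f => ?_⟩ hP
  rw [Measure.map_apply (measurable_shiftConfig g) (measurableSet_cylinder s f)]
  let σ : Γ × Fin d ≃ Γ × Fin d := (Equiv.mulLeft g).prodCongr (Equiv.refl _)
  have : shiftConfig g ⁻¹' {ω : Γ × Fin d → Bool | ∀ e ∈ s, ω e = f e} =
      {ω | ∀ e ∈ s.map σ.toEmbedding, ω e = (f ∘ σ.symm) e} := by
    ext ω
    simp only [mem_preimage, mem_ofPred_eq, Finset.forall_mem_map, Equiv.coe_toEmbedding,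
      Function.comp_apply, Equiv.symm_apply_apply]
    rfl
  rw [this, hP.2, Finset.prod_map]
  simp

/-! ### Connectivity -/

theorem Joins.symm {S : Fin d → Γ} {e : Γ × Fin d} {u v : Γ} (h : Joins S e u v) :
    Joins S e v u := Or.symm h

theorem OpenConn.symm {S : Fin d → Γ} {ω : Γ × Fin d → Bool} {u v : Γ} (h : OpenConn S ω u v) :
    OpenConn S ω v u :=
  have : Std.Symm fun a b => ∃ e, ω e = true ∧ Joins S e a b :=
    ⟨fun _ _ ⟨e, he, hj⟩ => ⟨e, he, hj.symm⟩⟩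
  Relation.ReflTransGen.stdSymm.symm _ _ h

theorem OpenConn.mono {S : Fin d → Γ} {ω η : Γ × Fin d → Bool}
    (h : ∀ e, ω e = true → η e = true) {u v : Γ} (huv : OpenConn S ω u v) : OpenConn S η u v :=
  Relation.ReflTransGen.mono (fun _ _ ⟨e, he, hj⟩ => ⟨e, h e he, hj⟩) _ _ huv

theorem OpenConn.of_shiftConfig {S : Fin d → Γ} {ω : Γ × Fin d → Bool} {g u v : Γ}
    (h : OpenConn S (shiftConfig g ω) u v) : OpenConn S ω (g * u) (g * v) := by
  refine Relation.ReflTransGen.lift (g * ·) (fun a b ⟨e, he, hj⟩ => ⟨(g * e.1, e.2), he, ?_⟩) _ _ h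
  rcases hj with ⟨rfl, rfl⟩ | ⟨rfl, rfl⟩
  · exact .inl ⟨rfl, (mul_assoc ..).symm⟩
  · exact .inr ⟨rfl, (mul_assoc ..).symm⟩

theorem openConn_iff_exists_finset [DecidableEq (Γ × Fin d)] {S : Fin d → Γ}
    {ω : Γ × Fin d → Bool} {u v : Γ} :
    OpenConn S ω u v ↔ ∃ F : Finset (Γ × Fin d), (∀ e ∈ F, ω e = true) ∧
      OpenConn S (fun e => decide (e ∈ F)) u v := by
  constructor
  · intro h
    induction h with
    | refl => exact ⟨∅, by simp, .refl⟩
    | tail _ hbc ih =>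
      obtain ⟨F, hF, hc⟩ := ih
      obtain ⟨e, he, hj⟩ := hbc
      refine ⟨insert e F, by simpa [he] using hF, ?_⟩
      exact (hc.mono (by simp +contextual)).tail ⟨e, by simp, hj⟩
  · rintro ⟨F, hF, hc⟩
    exact hc.mono (by simpa using hF)

theorem measurableSet_openConn [Countable Γ] (S : Fin d → Γ) (u v : Γ) :
    MeasurableSet {ω | OpenConn S ω u v} := by
  classical
  have : {ω | OpenConn S ω u v} = ⋃ F : Finset (Γ × Fin d), {ω | ∀ e ∈ F, ω e = true} ∩
      {_ω | OpenConn S (fun e => decide (e ∈ F)) u v} := by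
    ext ω
    rw [mem_ofPred_eq, openConn_iff_exists_finset]
    simp
  rw [this]
  refine MeasurableSet.iUnion fun F => ?_
  exact (measurableSet_cylinder F fun _ => true).inter (MeasurableSet.const _)

/-- The set of vertices connected to `K`. -/
def Reach (S : Fin d → Γ) (ω : Γ × Fin d → Bool) (K : Finset Γ) : Set Γ :=
  {v | ∃ u ∈ K, OpenConn S ω u v}

theorem reach_eq_biUnion_cluster (S : Fin d → Γ) (ω : Γ × Fin d → Bool) (K : Finset Γ) :
    Reach S ω K = ⋃ u ∈ K, Cluster S ω u := by
  ext; simp [Reach, Cluster]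

theorem exists_infinite_cluster {S : Fin d → Γ} {ω : Γ × Fin d → Bool} {K : Finset Γ}
    (h : ¬ (Reach S ω K).Finite) : ∃ u ∈ K, (Cluster S ω u).Infinite := by
  by_contra! hK
  rw [reach_eq_biUnion_cluster] at h
  exact h (K.finite_toSet.biUnion hK)

theorem measurableSet_encard_reach_le [Countable Γ] (S : Fin d → Γ) (K : Finset Γ) (N : ℕ) :
    MeasurableSet {ω | (Reach S ω K).encard ≤ N} := by
  have : {ω | (Reach S ω K).encard ≤ N} =
      (⋃ (V : Finset Γ) (_ : N < V.card), ⋂ v ∈ V, ⋃ u ∈ K, {ω | OpenConn S ω u v})ᶜ := by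
    ext ω
    simp only [mem_ofPred_eq, mem_compl_iff, mem_iUnion, mem_iInter, exists_prop, not_exists,
      not_and]
    constructor
    · intro h V hV hVr
      have h1 : (V : Set Γ).encard ≤ (Reach S ω K).encard := encard_le_encard hVr
      rw [encard_coe_eq_coe_finsetCard] at h1
      exact absurd (Nat.cast_le.1 (h1.trans h)) (by omega)
    · intro h
      by_contra! hlt
      obtain ⟨t, ht, htc⟩ := exists_subset_encard_eq (Order.add_one_le_of_lt hlt)
      have hfin : t.Finite := finite_of_encard_eq_coe (k := N + 1) (by simpa using htc)
      refine h hfin.toFinset ?_ fun v hv => ht (by simpa using hv)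
      have : ((hfin.toFinset.card : ℕ) : ℕ∞) = (N + 1 : ℕ) := by
        rw [← encard_coe_eq_coe_finsetCard]; simpa using htc
      have := Nat.cast_inj.1 this
      omega
  rw [this]
  refine (MeasurableSet.iUnion fun V => .iUnion fun _ => ?_).compl
  exact V.measurableSet_biInter fun v _ =>
    K.measurableSet_biUnion fun u _ => measurableSet_openConn S u v

theorem finite_reach_eq_iUnion (S : Fin d → Γ) (K : Finset Γ) :
    {ω | (Reach S ω K).Finite} = ⋃ N : ℕ, {ω | (Reach S ω K).encard ≤ N} := by
  ext ω
  simp only [mem_ofPred_eq, mem_iUnion]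
  constructor
  · intro h
    exact ⟨(Reach S ω K).ncard, h.cast_ncard_eq.ge⟩
  · rintro ⟨N, hN⟩
    exact finite_of_encard_le_coe hN

theorem measurableSet_finite_reach [Countable Γ] (S : Fin d → Γ) (K : Finset Γ) :
    MeasurableSet {ω | (Reach S ω K).Finite} := by
  rw [finite_reach_eq_iUnion]
  exact .iUnion fun N => measurableSet_encard_reach_le S K N

/-! ### Exploration of clusters -/

section Exploration

open Classical in
/-- The edge boundary of a finite set of vertices. -/
def edgeBdry (S : Fin d → Γ) (K : Finset Γ) : Finset (Γ × Fin d) :=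
  {e ∈ K ×ˢ (Finset.univ : Finset (Fin d)) | e.1 * S e.2 ∉ K} ∪
    {e ∈ (K ×ˢ (Finset.univ : Finset (Fin d))).image (fun e : Γ × Fin d => (e.1 * (S e.2)⁻¹, e.2)) | e.1 ∉ K}

theorem exists_joins_of_mem_edgeBdry {S : Fin d → Γ} {K : Finset Γ} {e : Γ × Fin d}
    (he : e ∈ edgeBdry S K) : ∃ u ∈ K, ∃ v ∉ K, Joins S e u v := by
  simp only [edgeBdry, Finset.mem_union, Finset.mem_filter, Finset.mem_product, Finset.mem_univ,
    and_true, Finset.mem_image, Prod.exists] at he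
  rcases he with ⟨h1, h2⟩ | ⟨⟨g, i, hg, rfl⟩, h2⟩
  · exact ⟨e.1, h1, _, h2, .inl ⟨rfl, rfl⟩⟩
  · exact ⟨g, hg, _, h2, .inr ⟨rfl, by simp⟩⟩

open Classical in
/-- Close the edges of `E`. -/
def closeEdges (E : Finset (Γ × Fin d)) (ω : Γ × Fin d → Bool) : Γ × Fin d → Bool :=
  fun e => ω e && decide (e ∉ E)

theorem measurable_closeEdges (E : Finset (Γ × Fin d)) : Measurable (closeEdges E) := by
  classical
  refine measurable_pi_lambda _ fun e => ?_
  exact (measurable_of_finite fun b : Bool => b && decide (e ∉ E)).comp (measurable_pi_apply e)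

theorem subset_reach (S : Fin d → Γ) (ω : Γ × Fin d → Bool) (K : Finset Γ) :
    (K : Set Γ) ⊆ Reach S ω K :=
  fun u hu => ⟨u, hu, .refl⟩

open Classical in
/-- Exploring the clusters of `K` edge by edge, if the edge boundary of every finite set `V` has at
least `d * |V|` edges, the clusters of `K` are small with probability at most `a ^ |K|`. -/
theorem measure_encard_reach_le [Countable Γ] {S : Fin d → Γ} {p : ℝ}
    {P : Measure (Γ × Fin d → Bool)} (hP : IsBernoulli S p P) (hp : p ∈ Icc (0 : ℝ) 1)
    (hiso : ∀ K : Finset Γ, d * K.card ≤ (edgeBdry S K).card) {a b : ℝ} (ha : 0 < a) (hb : 1 ≤ b)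
    (hab : p * a + (1 - p) * b = 1) (hd : 1 ≤ a * b ^ d) (N : ℕ) :
    ∀ (k m : ℕ) (K : Finset Γ) (E : Finset (Γ × Fin d)), N < K.card + k →
      (edgeBdry S K \ E).card ≤ m →
      P {ω | (Reach S (closeEdges E ω) K).encard ≤ N} ≤
        ENNReal.ofReal (a ^ K.card * b ^ E.card) := by
  have := hP.1
  intro k
  induction k with
  | zero =>
    intro m K E hK _
    have : {ω | (Reach S (closeEdges E ω) K).encard ≤ N} = ∅ := by
      ext ω
      simp only [mem_ofPred_eq, mem_empty_iff_false, iff_false, not_le]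
      refine lt_of_lt_of_le ?_ (encard_le_encard (subset_reach S _ K))
      rw [encard_coe_eq_coe_finsetCard]
      exact_mod_cast hK
    rw [this]
    simp
  | succ k ihk =>
    intro m
    induction m with
    | zero =>
      intro K E _ hE
      have hsub : edgeBdry S K ⊆ E :=
        Finset.sdiff_eq_empty_iff_subset.1 (Finset.card_eq_zero.1 (Nat.le_zero.1 hE))
      have hcard : d * K.card ≤ E.card := (hiso K).trans (Finset.card_le_card hsub)
      refine prob_le_one.trans (ENNReal.one_le_ofReal.2 ?_)
      calc (1 : ℝ) ≤ (a * b ^ d) ^ K.card := one_le_pow₀ hd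
        _ = a ^ K.card * b ^ (d * K.card) := by rw [mul_pow, pow_mul]
        _ ≤ a ^ K.card * b ^ E.card := by gcongr
    | succ m ihm =>
      intro K E hK hE
      by_cases hsub : (edgeBdry S K \ E).card = 0
      · exact ihm K E hK (hsub.le.trans (Nat.zero_le m))
      obtain ⟨e, he⟩ := Finset.card_pos.1 (Nat.pos_of_ne_zero hsub)
      obtain ⟨heb, heE⟩ := Finset.mem_sdiff.1 he
      obtain ⟨u, hu, v, hv, hj⟩ := exists_joins_of_mem_edgeBdry heb
      have hmeas : MeasurableSet {ω | (Reach S (closeEdges E ω) K).encard ≤ N} :=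
        measurable_closeEdges E (measurableSet_encard_reach_le S K N)
      have h_open : P ((fun ω => Function.update ω e true) ⁻¹'
          {ω | (Reach S (closeEdges E ω) K).encard ≤ N}) ≤
          ENNReal.ofReal (a ^ (K.card + 1) * b ^ E.card) := by
        have h := ihk (edgeBdry S (insert v K) \ E).card (insert v K) E (by rw [Finset.card_insert_of_notMem hv]; omega) le_rfl
        rw [Finset.card_insert_of_notMem hv] at h
        refine (measure_mono fun ω hω => ?_).trans h
        refine (encard_le_encard ?_).trans hω
        have hmono : ∀ x, closeEdges E ω x = true →
            closeEdges E (Function.update ω e true) x = true := by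
          intro x
          by_cases hx : x = e
          · subst hx; simp [closeEdges, heE]
          · simp [closeEdges, hx]
        rintro w ⟨y, hy, hyw⟩
        rcases Finset.mem_insert.1 hy with rfl | hy
        · exact ⟨u, hu, .head ⟨e, by simp [closeEdges, heE], hj⟩ (hyw.mono hmono)⟩
        · exact ⟨y, hy, hyw.mono hmono⟩
      have h_closed : P ((fun ω => Function.update ω e false) ⁻¹'
          {ω | (Reach S (closeEdges E ω) K).encard ≤ N}) ≤
          ENNReal.ofReal (a ^ K.card * b ^ (E.card + 1)) := by
        have h := ihm K (insert e E) hK (by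
          have h1 : (edgeBdry S K \ insert e E) = (edgeBdry S K \ E).erase e := by
            ext x; simp only [Finset.mem_sdiff, Finset.mem_insert, Finset.mem_erase]; tauto
          rw [h1, Finset.card_erase_of_mem he]
          omega)
        rw [Finset.card_insert_of_notMem heE] at h
        refine (measure_mono fun ω hω => ?_).trans h
        have : closeEdges E (Function.update ω e false) = closeEdges (insert e E) ω := by
          ext x
          by_cases hx : x = e
          · subst hx; simp [closeEdges]
          · simp [closeEdges, hx]
        simpa only [mem_ofPred_eq, mem_preimage, this] using hω
      rw [hP.eq_resample hp e]
      simp only [Measure.add_apply, Measure.smul_apply, smul_eq_mul]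
      rw [Measure.map_apply measurable_update_left hmeas,
        Measure.map_apply measurable_update_left hmeas]
      have h1p : 0 ≤ 1 - p := by linarith [hp.2]
      have hb0 : 0 < b := by linarith
      calc _ ≤ ENNReal.ofReal p * ENNReal.ofReal (a ^ (K.card + 1) * b ^ E.card) +
            ENNReal.ofReal (1 - p) * ENNReal.ofReal (a ^ K.card * b ^ (E.card + 1)) := by gcongr
        _ = ENNReal.ofReal (a ^ K.card * b ^ E.card) := by
          rw [← ENNReal.ofReal_mul hp.1, ← ENNReal.ofReal_mul h1p,
            ← ENNReal.ofReal_add (mul_nonneg hp.1 (by positivity))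
              (mul_nonneg h1p (by positivity))]
          congr 1
          linear_combination (a ^ K.card * b ^ E.card) * hab

theorem measure_finite_reach_le [Countable Γ] {S : Fin d → Γ} {p : ℝ}
    {P : Measure (Γ × Fin d → Bool)} (hP : IsBernoulli S p P) (hp : p ∈ Icc (0 : ℝ) 1)
    (hiso : ∀ K : Finset Γ, d * K.card ≤ (edgeBdry S K).card) {a b : ℝ} (ha : 0 < a) (hb : 1 ≤ b)
    (hab : p * a + (1 - p) * b = 1) (hd : 1 ≤ a * b ^ d) (K : Finset Γ) :
    P {ω | (Reach S ω K).Finite} ≤ ENNReal.ofReal (a ^ K.card) := by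
  classical
  have hmono : Monotone fun N : ℕ => {ω | (Reach S ω K).encard ≤ N} := by
    intro M N hMN ω hω
    simp only [mem_ofPred_eq] at *
    exact hω.trans (by exact_mod_cast hMN)
  rw [finite_reach_eq_iUnion, hmono.measure_iUnion]
  refine iSup_le fun N => ?_
  have h := measure_encard_reach_le hP hp hiso ha hb hab hd N (N + 1) (edgeBdry S K).card K ∅
    (by omega) (by simp)
  have hc : ∀ ω : Γ × Fin d → Bool, closeEdges ∅ ω = ω := fun ω => by ext; simp [closeEdges]
  simpa [hc] using h

/-- If every finite set `V` of vertices has at least `d * |V|` boundary edges, there is an infinite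
cluster for every `p > 1 / (d + 1)`. -/
theorem measure_percEvent_eq_one [Countable Γ] [Infinite Γ] {S : Fin d → Γ} {p : ℝ}
    {P : Measure (Γ × Fin d → Bool)} (hP : IsBernoulli S p P) (hp0 : 0 < p) (hp1 : p < 1)
    (hpd : 1 < p * (d + 1))
    (hiso : ∀ K : Finset Γ, d * K.card ≤ (edgeBdry S K).card) :
    P (PercEvent S) = 1 := by
  have := hP.1
  have h1p : 0 < 1 - p := by linarith
  have hdp : 1 - p < d * p := by linarith
  have hdp0 : 0 < d * p := h1p.trans hdp
  set a : ℝ := (1 - p) / (d * p) with ha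
  have ha0 : 0 < a := by positivity
  have ha1 : a < 1 := (div_lt_one hdp0).2 hdp
  set b : ℝ := 1 + p * (1 - a) / (1 - p) with hb
  have hx : 0 ≤ p * (1 - a) / (1 - p) := by
    have : 0 < 1 - a := by linarith
    positivity
  have hd : 1 ≤ a * b ^ d := by
    have h2 : 1 + (d : ℝ) * (p * (1 - a) / (1 - p)) ≤ b ^ d :=
      one_add_mul_le_pow (by linarith) d
    have h3 : a * (1 + (d : ℝ) * (p * (1 - a) / (1 - p))) = 1 := by
      have h4 : a * (d * p) = 1 - p := div_mul_cancel₀ _ hdp0.ne'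
      field_simp
      linear_combination (1 - a) * h4
    calc 1 = a * (1 + (d : ℝ) * (p * (1 - a) / (1 - p))) := h3.symm
      _ ≤ a * b ^ d := by gcongr
  have hle : ∀ n : ℕ, P (PercEvent S)ᶜ ≤ ENNReal.ofReal (a ^ n) := by
    intro n
    obtain ⟨K, hK⟩ := Infinite.exists_subset_card_eq Γ n
    rw [← hK]
    refine le_trans (measure_mono fun ω hω => ?_) (measure_finite_reach_le hP ⟨hp0.le, hp1.le⟩ hiso
      ha0 (by linarith) (by rw [hb]; field_simp; ring) hd K)
    by_contra hfin
    obtain ⟨u, -, hu⟩ := exists_infinite_cluster hfin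
    exact hω ⟨u, hu⟩
  have hzero : P (PercEvent S)ᶜ = 0 := by
    refine le_antisymm (ge_of_tendsto' (x := Filter.atTop) ?_ hle) bot_le
    have := ENNReal.tendsto_ofReal (tendsto_pow_atTop_nhds_zero_of_lt_one ha0.le ha1)
    simpa using this
  have hae : PercEvent S =ᵐ[P] univ := Filter.eventuallyEq_univ.2 (mem_ae_iff.2 hzero)
  rw [measure_congr hae, measure_univ]

end Exploration

/-! ### The random walk operator on finitely supported functions -/

/-- The function `g ↦ f (g * s)`. -/
def rightShift (s : Γ) (f : Γ →₀ ℝ) : Γ →₀ ℝ := Finsupp.equivMapDomain (Equiv.mulRight s⁻¹) f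

@[simp]
theorem rightShift_apply (s : Γ) (f : Γ →₀ ℝ) (g : Γ) : rightShift s f g = f (g * s) := by
  simp [rightShift]

/-- The random walk operator on finitely supported functions. -/
def walkOp (S : Fin d → Γ) (f : Γ →₀ ℝ) : Γ →₀ ℝ := (d : ℝ)⁻¹ • ∑ i, rightShift (S i) f

/-- The adjoint of the random walk operator on finitely supported functions. -/
def walkOpAdj (S : Fin d → Γ) (f : Γ →₀ ℝ) : Γ →₀ ℝ := (d : ℝ)⁻¹ • ∑ i, rightShift (S i)⁻¹ f

theorem walkOp_apply (S : Fin d → Γ) (f : Γ →₀ ℝ) (g : Γ) :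
    walkOp S f g = (d : ℝ)⁻¹ * ∑ i, f (g * S i) := by
  simp [walkOp]

theorem walkOpAdj_apply (S : Fin d → Γ) (f : Γ →₀ ℝ) (g : Γ) :
    walkOpAdj S f g = (d : ℝ)⁻¹ * ∑ i, f (g * (S i)⁻¹) := by
  simp [walkOpAdj]

theorem coe_walkOp (S : Fin d → Γ) (f : Γ →₀ ℝ) : ⇑(walkOp S f) = rwOp S f := by
  ext g
  rw [walkOp_apply, rwOp, div_eq_inv_mul]

theorem Finsupp.summable_mul_fun (f : Γ →₀ ℝ) (h : Γ → ℝ) : Summable fun g => f g * h g :=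
  summable_of_hasFiniteSupport <| f.hasFiniteSupport.subset fun g hg hf => hg (by simp [hf])

theorem Finsupp.summable_sq (f : Γ →₀ ℝ) : Summable fun g => f g ^ 2 := by
  simpa only [sq] using Finsupp.summable_mul_fun f f

theorem tsum_walkOp_mul (S : Fin d → Γ) (f h : Γ →₀ ℝ) :
    ∑' g, walkOp S f g * h g = ∑' g, f g * walkOpAdj S h g := by
  have hl : ∀ i, Summable fun g => f (g * S i) * h g := fun i => by
    simpa using Finsupp.summable_mul_fun (rightShift (S i) f) h
  have hr : ∀ i, Summable fun g => f g * h (g * (S i)⁻¹) := fun i =>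
    Finsupp.summable_mul_fun f _
  calc ∑' g, walkOp S f g * h g = ∑' g, (d : ℝ)⁻¹ * ∑ i, f (g * S i) * h g := by
        simp only [walkOp_apply, mul_assoc, Finset.sum_mul]
    _ = (d : ℝ)⁻¹ * ∑ i, ∑' g, f (g * S i) * h g := by
        rw [tsum_mul_left, Summable.tsum_finsetSum fun i _ => hl i]
    _ = (d : ℝ)⁻¹ * ∑ i, ∑' g, f g * h (g * (S i)⁻¹) := by
        congr 1
        refine Finset.sum_congr rfl fun i _ => ?_
        rw [← (Equiv.mulRight (S i)).tsum_eq fun g => f g * h (g * (S i)⁻¹)]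
        simp
    _ = ∑' g, (d : ℝ)⁻¹ * ∑ i, f g * h (g * (S i)⁻¹) := by
        rw [tsum_mul_left, Summable.tsum_finsetSum fun i _ => hr i]
    _ = _ := by
        refine tsum_congr fun g => ?_
        rw [walkOpAdj_apply, ← Finset.mul_sum]
        ring

theorem tsum_rwOp_sq_le (S : Fin d → Γ) (f : Γ →₀ ℝ) :
    ∑' g, rwOp S f g ^ 2 ≤ ∑' g, f g ^ 2 := by
  rcases Nat.eq_zero_or_pos d with rfl | hd
  · simp only [rwOp, Nat.cast_zero, div_zero, ne_eq, OfNat.ofNat_ne_zero, not_false_eq_true,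
      zero_pow, tsum_zero]
    exact tsum_nonneg fun g => sq_nonneg _
  have hd' : (0 : ℝ) < d := by exact_mod_cast hd
  have hs : ∀ i, Summable fun g => f (g * S i) ^ 2 := fun i => by
    simpa using Finsupp.summable_sq (rightShift (S i) f)
  calc ∑' g, rwOp S f g ^ 2 ≤ ∑' g, (d : ℝ)⁻¹ * ∑ i, f (g * S i) ^ 2 := by
        refine Summable.tsum_le_tsum (fun g => ?_) ?_ ((summable_sum fun i _ => hs i).mul_left _)
        · have := sq_sum_le_card_mul_sum_sq (s := Finset.univ) (f := fun i => f (g * S i))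
          rw [rwOp, div_pow, div_le_iff₀ (by positivity)]
          calc _ ≤ _ := this
            _ = _ := by rw [Finset.card_univ, Fintype.card_fin]; field_simp
        · simpa [coe_walkOp] using Finsupp.summable_sq (walkOp S f)
    _ = (d : ℝ)⁻¹ * ∑ i, ∑' g, f (g * S i) ^ 2 := by
        rw [tsum_mul_left, Summable.tsum_finsetSum fun i _ => hs i]
    _ = (d : ℝ)⁻¹ * ∑ i : Fin d, ∑' g, f g ^ 2 := by
        congr 1
        refine Finset.sum_congr rfl fun i _ => ?_
        exact (Equiv.mulRight (S i)).tsum_eq fun g => f g ^ 2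
    _ = _ := by
        rw [Finset.sum_const, Finset.card_univ, Fintype.card_fin, nsmul_eq_mul,
          inv_mul_cancel_left₀ hd'.ne']

theorem l2norm_rwOp_le_specRad (S : Fin d → Γ) (f : Γ →₀ ℝ) :
    l2norm (rwOp S f) ≤ specRad S * l2norm f := by
  have hset : {c : ℝ | 0 ≤ c ∧ ∀ f : Γ →₀ ℝ, l2norm (rwOp S ⇑f) ≤ c * l2norm ⇑f} =
      Ici 0 ∩ ⋂ f : Γ →₀ ℝ, {c | l2norm (rwOp S ⇑f) ≤ c * l2norm ⇑f} := by
    ext; simp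
  have hclosed : IsClosed {c : ℝ | 0 ≤ c ∧ ∀ f : Γ →₀ ℝ, l2norm (rwOp S ⇑f) ≤ c * l2norm ⇑f} := by
    rw [hset]
    exact isClosed_Ici.inter <| isClosed_iInter fun f =>
      isClosed_le continuous_const (continuous_id.mul continuous_const)
  refine (hclosed.csInf_mem ⟨1, zero_le_one, fun f => ?_⟩ ⟨0, fun c hc => hc.1⟩).2 f
  rw [one_mul]
  exact Real.sqrt_le_sqrt (tsum_rwOp_sq_le S f)

section HalfContraction

variable {S : Fin d → Γ} (hrho : specRad S ≤ 1 / 2)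
include hrho

theorem tsum_walkOp_sq_le (f : Γ →₀ ℝ) :
    ∑' g, walkOp S f g ^ 2 ≤ (1 / 4) * ∑' g, f g ^ 2 := by
  have hf : 0 ≤ ∑' g, f g ^ 2 := tsum_nonneg fun g => sq_nonneg _
  have h := (l2norm_rwOp_le_specRad S f).trans
    (mul_le_mul_of_nonneg_right hrho (Real.sqrt_nonneg _))
  rw [← coe_walkOp, l2norm, l2norm, Real.sqrt_le_left (by positivity), mul_pow,
    Real.sq_sqrt hf] at h
  linarith

theorem tsum_walkOpAdj_sq_le (f : Γ →₀ ℝ) :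
    ∑' g, walkOpAdj S f g ^ 2 ≤ (1 / 4) * ∑' g, f g ^ 2 := by
  have h1 : ∑' g, walkOpAdj S f g ^ 2 = ∑' g, walkOp S (walkOpAdj S f) g * f g := by
    rw [tsum_walkOp_mul]
    simp only [sq]
  have h2 : ∑' g, walkOp S (walkOpAdj S f) g * f g ≤
      ∑' g, (2 * walkOp S (walkOpAdj S f) g ^ 2 + (1 / 8) * f g ^ 2) :=
    Summable.tsum_le_tsum (fun g => by
      linarith [sq_nonneg (4 * walkOp S (walkOpAdj S f) g - f g)])
      (Finsupp.summable_mul_fun _ _)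
      (((Finsupp.summable_sq _).mul_left _).add ((Finsupp.summable_sq _).mul_left _))
  rw [Summable.tsum_add ((Finsupp.summable_sq _).mul_left _) ((Finsupp.summable_sq _).mul_left _),
    tsum_mul_left, tsum_mul_left] at h2
  linarith [tsum_walkOp_sq_le hrho (walkOpAdj S f)]

theorem tsum_walkOp_add_walkOpAdj_sq_le (f : Γ →₀ ℝ) :
    ∑' g, (walkOp S f + walkOpAdj S f) g ^ 2 ≤ ∑' g, f g ^ 2 := by
  have h2 : ∑' g, (walkOp S f + walkOpAdj S f) g ^ 2 ≤
      ∑' g, (2 * walkOp S f g ^ 2 + 2 * walkOpAdj S f g ^ 2) :=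
    Summable.tsum_le_tsum (fun g => by
      rw [Finsupp.add_apply]
      linarith [sq_nonneg (walkOp S f g - walkOpAdj S f g)])
      (Finsupp.summable_sq _)
      (((Finsupp.summable_sq _).mul_left _).add ((Finsupp.summable_sq _).mul_left _))
  rw [Summable.tsum_add ((Finsupp.summable_sq _).mul_left _) ((Finsupp.summable_sq _).mul_left _),
    tsum_mul_left, tsum_mul_left] at h2
  linarith [tsum_walkOp_sq_le hrho f, tsum_walkOpAdj_sq_le hrho f]

theorem tsum_walkOp_mul_self_le (f : Γ →₀ ℝ) :
    ∑' g, walkOp S f g * f g ≤ (1 / 2) * ∑' g, f g ^ 2 := by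
  have h2 : ∑' g, walkOp S f g * f g ≤
      ∑' g, (walkOp S f g ^ 2 + (1 / 4) * f g ^ 2) :=
    Summable.tsum_le_tsum (fun g => by
      linarith [sq_nonneg (walkOp S f g - (1 / 2) * f g)])
      (Finsupp.summable_mul_fun _ _)
      ((Finsupp.summable_sq _).add ((Finsupp.summable_sq _).mul_left _))
  rw [Summable.tsum_add (Finsupp.summable_sq _) ((Finsupp.summable_sq _).mul_left _),
    tsum_mul_left] at h2
  linarith [tsum_walkOp_sq_le hrho f]

open Classical in
/-- The isoperimetric inequality. -/
theorem card_le_card_edgeBdry (K : Finset Γ) : d * K.card ≤ (edgeBdry S K).card := by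
  let A : Finset (Γ × Fin d) := {e ∈ K ×ˢ Finset.univ | e.1 * S e.2 ∉ K}
  let B : Finset (Γ × Fin d) := {e ∈ K ×ˢ Finset.univ | e.1 * (S e.2)⁻¹ ∉ K}
  let I : Finset (Γ × Fin d) := {e ∈ K ×ˢ Finset.univ | e.1 * S e.2 ∈ K}
  let J : Finset (Γ × Fin d) := {e ∈ K ×ˢ Finset.univ | e.1 * (S e.2)⁻¹ ∈ K}
  have hIA : I.card + A.card = d * K.card := by
    rw [Finset.card_filter_add_card_filter_not, Finset.card_product, Finset.card_univ,
      Fintype.card_fin, mul_comm]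
  have hJB : J.card + B.card = d * K.card := by
    rw [Finset.card_filter_add_card_filter_not, Finset.card_product, Finset.card_univ,
      Fintype.card_fin, mul_comm]
  have hIJ : I.card = J.card := by
    refine Finset.card_bij (fun e _ => (e.1 * S e.2, e.2)) ?_ ?_ ?_
    · intro e he
      simp only [I, J, Finset.mem_filter, Finset.mem_product, Finset.mem_univ, and_true] at he ⊢
      exact ⟨he.2, by simpa using he.1⟩
    · rintro ⟨g, i⟩ _ ⟨h, j⟩ _ heq
      simp only [Prod.mk.injEq] at heq ⊢
      obtain ⟨h1, rfl⟩ := heq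
      exact ⟨mul_right_cancel h1, rfl⟩
    · intro e he
      simp only [I, J, Finset.mem_filter, Finset.mem_product, Finset.mem_univ, and_true] at he ⊢
      exact ⟨(e.1 * (S e.2)⁻¹, e.2), ⟨he.2, by simpa using he.1⟩, by simp⟩
  have hbd : (edgeBdry S K).card = A.card + B.card := by
    rw [edgeBdry, Finset.card_union_of_disjoint]
    · congr 1
      have hinj : Function.Injective fun e : Γ × Fin d => (e.1 * (S e.2)⁻¹, e.2) := by
        rintro ⟨g, i⟩ ⟨h, j⟩ heq
        simp only [Prod.mk.injEq] at heq ⊢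
        obtain ⟨h1, rfl⟩ := heq
        exact ⟨mul_right_cancel h1, rfl⟩
      rw [Finset.filter_image, Finset.card_image_of_injective _ hinj]
    · rw [Finset.disjoint_left]
      intro e he he'
      simp only [Finset.mem_filter, Finset.mem_product] at he he'
      exact he'.2 he.1.1
  have hI : 2 * I.card ≤ d * K.card := by
    let f : Γ →₀ ℝ := Finsupp.onFinset K (fun g => if g ∈ K then 1 else 0) (by simp)
    have hfg : ∀ g, f g = if g ∈ K then 1 else 0 := fun g => rfl
    have hf : ∑' g, f g ^ 2 = K.card := by
      rw [tsum_eq_sum (s := K) (by simp +contextual [hfg])]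
      simp +contextual [hfg]
    have hPf : ∑' g, walkOp S f g * f g = (d : ℝ)⁻¹ * I.card := by
      rw [tsum_eq_sum (s := K) (by simp +contextual [hfg]), Finset.card_filter, Nat.cast_sum,
        Finset.sum_product, Finset.mul_sum]
      refine Finset.sum_congr rfl fun g hg => ?_
      simp [walkOp_apply, hfg, hg]
    have h := tsum_walkOp_mul_self_le hrho f
    rw [hf, hPf] at h
    rcases Nat.eq_zero_or_pos d with rfl | hd
    · have : I.card + A.card = 0 := by simpa using hIA
      omega
    · have hd' : (0 : ℝ) < d := by exact_mod_cast hd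
      rw [inv_mul_le_iff₀ hd'] at h
      have : (2 * I.card : ℝ) ≤ d * K.card := by linarith
      exact_mod_cast this
  omega

end HalfContraction

/-! ### Open paths -/

/-- The generator or inverse generator labelled by `x`. -/
def letter (S : Fin d → Γ) (x : Fin d × Bool) : Γ := if x.2 then S x.1 else (S x.1)⁻¹

/-- The edge joining `g` to `g * letter S x`. -/
def stepEdge (S : Fin d → Γ) (g : Γ) (x : Fin d × Bool) : Γ × Fin d :=
  if x.2 then (g, x.1) else (g * (S x.1)⁻¹, x.1)

/-- The element represented by a word. -/
def wordProd (S : Fin d → Γ) (w : List (Fin d × Bool)) : Γ := (w.map (letter S)).prod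

/-- The edges traversed by the path that starts at `g` and is labelled by a word. -/
def wordEdges (S : Fin d → Γ) : Γ → List (Fin d × Bool) → List (Γ × Fin d)
  | _, [] => []
  | g, x :: w => stepEdge S g x :: wordEdges S (g * letter S x) w

/-- The vertices visited by the path that starts at `g` and is labelled by a word. -/
def wordVerts (S : Fin d → Γ) : Γ → List (Fin d × Bool) → List Γ
  | g, [] => [g]
  | g, x :: w => g :: wordVerts S (g * letter S x) w

@[simp]
theorem wordProd_nil (S : Fin d → Γ) : wordProd S [] = 1 := rfl

@[simp]
theorem wordProd_cons (S : Fin d → Γ) (x : Fin d × Bool) (w : List (Fin d × Bool)) :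
    wordProd S (x :: w) = letter S x * wordProd S w := by
  simp [wordProd]

theorem length_wordEdges (S : Fin d → Γ) (w : List (Fin d × Bool)) :
    ∀ g, (wordEdges S g w).length = w.length := by
  induction w with
  | nil => simp [wordEdges]
  | cons x w ih => simp [wordEdges, ih]

theorem joins_stepEdge (S : Fin d → Γ) (g : Γ) (x : Fin d × Bool) :
    Joins S (stepEdge S g x) g (g * letter S x) := by
  rcases x with ⟨i, _ | _⟩
  · exact .inr ⟨by simp [stepEdge, letter], by simp [stepEdge]⟩
  · exact .inl ⟨by simp [stepEdge], by simp [stepEdge, letter]⟩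

theorem Joins.exists_stepEdge {S : Fin d → Γ} {e : Γ × Fin d} {u v : Γ} (h : Joins S e u v) :
    ∃ x, stepEdge S u x = e ∧ u * letter S x = v := by
  rcases h with ⟨rfl, rfl⟩ | ⟨rfl, rfl⟩
  · exact ⟨(e.2, true), by simp [stepEdge], by simp [letter]⟩
  · exact ⟨(e.2, false), by simp [stepEdge], by simp [letter]⟩

theorem Joins.eq_or_eq {S : Fin d → Γ} {e : Γ × Fin d} {u v a b : Γ} (h : Joins S e u v)
    (h' : Joins S e a b) : u = a ∨ u = b := by
  rcases h with ⟨rfl, rfl⟩ | ⟨rfl, rfl⟩ <;> rcases h' with ⟨rfl, rfl⟩ | ⟨rfl, rfl⟩ <;> simp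

theorem mem_wordVerts_self (S : Fin d → Γ) (g : Γ) (w : List (Fin d × Bool)) :
    g ∈ wordVerts S g w := by
  cases w <;> simp [wordVerts]

theorem mem_wordVerts_of_mem_wordEdges {S : Fin d → Γ} {w : List (Fin d × Bool)} :
    ∀ {g : Γ} {e : Γ × Fin d} {u v : Γ}, e ∈ wordEdges S g w → Joins S e u v →
      u ∈ wordVerts S g w := by
  induction w with
  | nil => simp [wordEdges]
  | cons x w ih =>
    intro g e u v he hj
    rcases List.mem_cons.1 he with rfl | he
    · rcases hj.eq_or_eq (joins_stepEdge S g x) with rfl | rfl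
      · exact List.mem_cons_self
      · exact List.mem_cons_of_mem _ (mem_wordVerts_self S _ w)
    · exact List.mem_cons_of_mem _ (ih he hj)

theorem nodup_wordEdges {S : Fin d → Γ} {w : List (Fin d × Bool)} :
    ∀ {g : Γ}, (wordVerts S g w).Nodup → (wordEdges S g w).Nodup := by
  induction w with
  | nil => simp [wordEdges]
  | cons x w ih =>
    intro g h
    obtain ⟨h1, h2⟩ := List.nodup_cons.1 h
    exact List.nodup_cons.2
      ⟨fun he => h1 (mem_wordVerts_of_mem_wordEdges he (joins_stepEdge S g x)), ih h2⟩

theorem exists_suffix_of_mem_wordVerts {S : Fin d → Γ} {ω : Γ × Fin d → Bool} {u : Γ}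
    {w : List (Fin d × Bool)} :
    ∀ {g : Γ}, u ∈ wordVerts S g w → (wordVerts S g w).Nodup →
      (∀ e ∈ wordEdges S g w, ω e = true) →
      ∃ w', u * wordProd S w' = g * wordProd S w ∧ (wordVerts S u w').Nodup ∧
        ∀ e ∈ wordEdges S u w', ω e = true := by
  induction w with
  | nil =>
    intro g hu hn ho
    obtain rfl : u = g := by simpa [wordVerts] using hu
    exact ⟨[], rfl, hn, ho⟩
  | cons x w ih =>
    intro g hu hn ho
    rcases List.mem_cons.1 hu with rfl | hu
    · exact ⟨_, rfl, hn, ho⟩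
    · obtain ⟨w', h1, h2⟩ := ih hu (List.nodup_cons.1 hn).2
        fun e he => ho e (List.mem_cons_of_mem _ he)
      exact ⟨w', by rw [h1, wordProd_cons, mul_assoc], h2⟩

/-- Connected vertices are joined by an open path without repeated edges. -/
theorem OpenConn.exists_path {S : Fin d → Γ} {ω : Γ × Fin d → Bool} {u v : Γ}
    (h : OpenConn S ω u v) :
    ∃ w, u * wordProd S w = v ∧ (wordEdges S u w).Nodup ∧ ∀ e ∈ wordEdges S u w, ω e = true := by
  suffices ∃ w, u * wordProd S w = v ∧ (wordVerts S u w).Nodup ∧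
      ∀ e ∈ wordEdges S u w, ω e = true by
    obtain ⟨w, h1, h2, h3⟩ := this
    exact ⟨w, h1, nodup_wordEdges h2, h3⟩
  induction h using Relation.ReflTransGen.head_induction_on with
  | refl => exact ⟨[], by simp, by simp [wordVerts], by simp [wordEdges]⟩
  | @head a c hac _ ih =>
    obtain ⟨e, he, hj⟩ := hac
    obtain ⟨w, h1, h2, h3⟩ := ih
    obtain ⟨x, rfl, rfl⟩ := hj.exists_stepEdge
    by_cases ha : a ∈ wordVerts S (a * letter S x) w
    · obtain ⟨w', h4, h5⟩ := exists_suffix_of_mem_wordVerts ha h2 h3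
      exact ⟨w', h4.trans h1, h5⟩
    · refine ⟨x :: w, by rw [wordProd_cons, ← mul_assoc, h1], List.nodup_cons.2 ⟨ha, h2⟩, ?_⟩
      intro e he'
      rcases List.mem_cons.1 he' with rfl | he'
      · exact he
      · exact h3 e he'

theorem exists_wordProd_eq {S : Fin d → Γ} (hgen : Subgroup.closure (Set.range S) = ⊤) (g : Γ) :
    ∃ w, wordProd S w = g := by
  have hg : g ∈ Subgroup.closure (Set.range S) := by simp [hgen]
  induction hg using Subgroup.closure_induction_left with
  | one => exact ⟨[], rfl⟩
  | mul_left x hx y _ ih =>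
    obtain ⟨i, rfl⟩ := hx
    obtain ⟨w, rfl⟩ := ih
    exact ⟨(i, true) :: w, by simp [letter]⟩
  | inv_mul_cancel x hx y _ ih =>
    obtain ⟨i, rfl⟩ := hx
    obtain ⟨w, rfl⟩ := ih
    exact ⟨(i, false) :: w, by simp [letter]⟩

theorem openConn_of_forall_eq_true {S : Fin d → Γ}
    (hgen : Subgroup.closure (Set.range S) = ⊤) {ω : Γ × Fin d → Bool} (hω : ∀ e, ω e = true)
    (u v : Γ) : OpenConn S ω u v := by
  obtain ⟨w, hw⟩ := exists_wordProd_eq hgen (u⁻¹ * v)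
  have key : ∀ (w : List (Fin d × Bool)) (u : Γ), OpenConn S ω u (u * wordProd S w) := by
    intro w
    induction w with
    | nil => intro u; rw [wordProd_nil, mul_one]; exact .refl
    | cons x w ih =>
      intro u
      rw [wordProd_cons, ← mul_assoc]
      exact .head ⟨_, hω _, joins_stepEdge S u x⟩ (ih _)
  simpa [hw] using key w u

/-! ### Counting words -/

open Classical in
/-- The words of length `n`. -/
def wordsOfLength (d : ℕ) : ℕ → Finset (List (Fin d × Bool))
  | 0 => {[]}
  | n + 1 => (Finset.univ ×ˢ wordsOfLength d n).image fun q => q.1 :: q.2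

theorem mem_wordsOfLength {n : ℕ} {w : List (Fin d × Bool)} :
    w ∈ wordsOfLength d n ↔ w.length = n := by
  induction n generalizing w with
  | zero => simp [wordsOfLength]
  | succ n ih =>
    cases w with
    | nil => simp [wordsOfLength]
    | cons x w => simp [wordsOfLength, ih]

/-- Applying `d` times the symmetrized walk `n` times to the indicator of `v`. -/
def walkIter (S : Fin d → Γ) (v : Γ) : ℕ → Γ →₀ ℝ
  | 0 => Finsupp.single v 1
  | n + 1 => (d : ℝ) • (walkOp S (walkIter S v n) + walkOpAdj S (walkIter S v n))

open Classical in
theorem card_words_eq_walkIter (S : Fin d → Γ) (v : Γ) (n : ℕ) :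
    ∀ u : Γ, (({w ∈ wordsOfLength d n | u * wordProd S w = v}.card : ℕ) : ℝ) =
      walkIter S v n u := by
  induction n with
  | zero =>
    intro u
    by_cases h : u = v <;> simp [wordsOfLength, walkIter, h, Finset.filter_singleton]
  | succ n ih =>
    intro u
    rcases Nat.eq_zero_or_pos d with rfl | hd
    · simp [wordsOfLength, walkIter]
    have hd' : (d : ℝ) ≠ 0 := by exact_mod_cast hd.ne'
    have hinj : Function.Injective
        fun q : (Fin d × Bool) × List (Fin d × Bool) => q.1 :: q.2 := by
      rintro ⟨a, b⟩ ⟨a', b'⟩ h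
      simpa using h
    rw [Finset.card_filter, wordsOfLength, Finset.sum_image hinj.injOn, Finset.sum_product,
      Fintype.sum_prod_type, Nat.cast_sum, walkIter, Finsupp.smul_apply, Finsupp.add_apply,
      walkOp_apply, walkOpAdj_apply, smul_eq_mul, mul_add, mul_inv_cancel_left₀ hd',
      mul_inv_cancel_left₀ hd', ← Finset.sum_add_distrib]
    refine Finset.sum_congr rfl fun i _ => ?_
    rw [Fintype.sum_bool, ← ih, ← ih, Finset.card_filter, Finset.card_filter]
    simp [letter, mul_assoc]

theorem walkIter_le {S : Fin d → Γ} (hrho : specRad S ≤ 1 / 2) (v u : Γ) (n : ℕ) :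
    walkIter S v n u ≤ (d : ℝ) ^ n := by
  have hn : ∑' g, walkIter S v n g ^ 2 ≤ ((d : ℝ) ^ n) ^ 2 := by
    induction n with
    | zero =>
      rw [tsum_eq_single v fun g hg => by simp [walkIter, Finsupp.single_eq_of_ne hg]]
      simp [walkIter]
    | succ n ih =>
      have h : ∀ g, walkIter S v (n + 1) g ^ 2 = (d : ℝ) ^ 2 *
          (walkOp S (walkIter S v n) + walkOpAdj S (walkIter S v n)) g ^ 2 := fun g => by
        rw [walkIter, Finsupp.smul_apply, smul_eq_mul, mul_pow]
      calc _ = (d : ℝ) ^ 2 *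
            ∑' g, (walkOp S (walkIter S v n) + walkOpAdj S (walkIter S v n)) g ^ 2 := by
            rw [← tsum_mul_left]; exact tsum_congr h
        _ ≤ (d : ℝ) ^ 2 * ((d : ℝ) ^ n) ^ 2 := by
            gcongr
            exact (tsum_walkOp_add_walkOpAdj_sq_le hrho _).trans ih
        _ = _ := by ring
  have hu : walkIter S v n u ^ 2 ≤ ∑' g, walkIter S v n g ^ 2 :=
    (Finsupp.summable_sq _).le_tsum u fun _ _ => sq_nonneg _
  exact le_of_sq_le_sq (hu.trans hn) (by positivity)

/-! ### Non-uniqueness below `1 / d` -/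

section Uniqueness

variable {S : Fin d → Γ} {p : ℝ} {P : Measure (Γ × Fin d → Bool)}

theorem measure_wordEdges_open (hP : IsBernoulli S p P) (hp : 0 ≤ p) (u : Γ)
    {w : List (Fin d × Bool)} (hw : (wordEdges S u w).Nodup) :
    P {ω | ∀ e ∈ wordEdges S u w, ω e = true} = ENNReal.ofReal (p ^ w.length) := by
  classical
  have h := hP.2 (wordEdges S u w).toFinset fun _ => true
  simp only [List.mem_toFinset, if_true, Finset.prod_const, List.toFinset_card_of_nodup hw,
    length_wordEdges] at h
  rw [h, ENNReal.ofReal_pow hp]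

/-- Vertices at distance at least `m` are connected with exponentially small probability. -/
theorem measure_openConn_le (hrho : specRad S ≤ 1 / 2) (hP : IsBernoulli S p P) (hp : 0 ≤ p)
    (hpd : p * d < 1) (m : ℕ) {u v : Γ}
    (hball : ∀ w : List (Fin d × Bool), w.length < m → u * wordProd S w ≠ v) :
    P {ω | OpenConn S ω u v} ≤ ENNReal.ofReal ((p * d) ^ m / (1 - p * d)) := by
  classical
  have hpd0 : 0 ≤ p * d := by positivity
  let W : ℕ → Finset (List (Fin d × Bool)) := fun n =>
    {w ∈ wordsOfLength d (m + n) | u * wordProd S w = v}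
  have hsub : {ω | OpenConn S ω u v} ⊆ ⋃ n, ⋃ w ∈ {w ∈ W n | (wordEdges S u w).Nodup},
      {ω | ∀ e ∈ wordEdges S u w, ω e = true} := by
    intro ω hω
    obtain ⟨w, h1, h2, h3⟩ := OpenConn.exists_path hω
    have hm : m ≤ w.length := not_lt.1 fun h => hball w h h1
    refine mem_iUnion.2 ⟨w.length - m, mem_iUnion₂.2 ⟨w, ?_, h3⟩⟩
    simp only [W, Finset.mem_filter, mem_wordsOfLength]
    exact ⟨⟨by omega, h1⟩, h2⟩
  have hterm : ∀ n, P (⋃ w ∈ {w ∈ W n | (wordEdges S u w).Nodup},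
      {ω | ∀ e ∈ wordEdges S u w, ω e = true}) ≤ ENNReal.ofReal ((p * d) ^ (m + n)) := by
    intro n
    calc _ ≤ ∑ w ∈ {w ∈ W n | (wordEdges S u w).Nodup},
          P {ω | ∀ e ∈ wordEdges S u w, ω e = true} := measure_biUnion_finset_le _ _
      _ = ∑ w ∈ {w ∈ W n | (wordEdges S u w).Nodup}, ENNReal.ofReal (p ^ (m + n)) := by
          refine Finset.sum_congr rfl fun w hw => ?_
          simp only [W, Finset.mem_filter, mem_wordsOfLength] at hw
          rw [measure_wordEdges_open hP hp u hw.2, hw.1.1]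
      _ ≤ ∑ w ∈ W n, ENNReal.ofReal (p ^ (m + n)) :=
          Finset.sum_le_sum_of_subset (Finset.filter_subset _ _)
      _ = ENNReal.ofReal ((W n).card * p ^ (m + n)) := by
          rw [Finset.sum_const, nsmul_eq_mul, ENNReal.ofReal_mul (Nat.cast_nonneg _),
            ENNReal.ofReal_natCast]
      _ ≤ ENNReal.ofReal ((p * d) ^ (m + n)) := by
          refine ENNReal.ofReal_le_ofReal ?_
          rw [mul_pow, mul_comm]
          gcongr
          rw [card_words_eq_walkIter]
          exact walkIter_le hrho v u _
  calc P {ω | OpenConn S ω u v} ≤ ∑' n, ENNReal.ofReal ((p * d) ^ (m + n)) :=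
        (measure_mono hsub).trans ((measure_iUnion_le _).trans (ENNReal.tsum_le_tsum hterm))
    _ = ENNReal.ofReal ((p * d) ^ m / (1 - p * d)) := by
        simp only [pow_add]
        rw [← ENNReal.ofReal_tsum_of_nonneg (fun n => by positivity)
          ((summable_geometric_of_lt_one hpd0 hpd).mul_left _), tsum_mul_left,
          tsum_geometric_of_lt_one hpd0 hpd, div_eq_mul_inv]

open Classical in
theorem measure_finite_reach_translate_le [Countable Γ] (hP : IsBernoulli S p P) (g : Γ)
    (K : Finset Γ) :
    P {ω | (Reach S ω (K.image (g * ·))).Finite} ≤ P {ω | (Reach S ω K).Finite} := by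
  conv_rhs => rw [← hP.map_shiftConfig g]
  rw [Measure.map_apply (measurable_shiftConfig g) (measurableSet_finite_reach S K)]
  refine measure_mono fun ω hω => ?_
  refine Finite.of_finite_image (f := (g * ·)) (hω.subset ?_) (mul_right_injective g).injOn
  rintro _ ⟨v, ⟨u, hu, huv⟩, rfl⟩
  exact ⟨g * u, Finset.mem_image_of_mem _ hu, huv.of_shiftConfig⟩

/-- Some finite set meets an infinite cluster with probability at least `3 / 4`. -/
theorem exists_measure_finite_reach_le [Countable Γ] (hP : IsBernoulli S p P)
    (hU : P (UniqueEvent S) = 1) : ∃ K, P {ω | (Reach S ω K).Finite} ≤ 1 / 4 := by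
  classical
  have := hP.1
  let A : Finset Γ → Set (Γ × Fin d → Bool) := fun K => {ω | (Reach S ω K).Finite}ᶜ
  have hmono : Monotone A := by
    intro K L hKL ω hω hfin
    exact hω (hfin.subset fun v ⟨u, hu, huv⟩ => ⟨u, hKL hu, huv⟩)
  have hsub : UniqueEvent S ⊆ ⋃ K, A K := by
    rintro ω ⟨_, ⟨⟨v, rfl⟩, hinf⟩, -⟩
    refine mem_iUnion.2 ⟨{v}, fun hfin => hinf (hfin.subset ?_)⟩
    exact fun u hu => ⟨v, by simp, hu⟩
  have h1 : 1 ≤ ⨆ K, P (A K) := by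
    rw [← hmono.measure_iUnion, ← hU]
    exact measure_mono hsub
  have h34 : (3 / 4 : ENNReal) < 1 :=
    ENNReal.div_lt_of_lt_mul (by norm_num)
  obtain ⟨K, hK⟩ := lt_iSup_iff.1 (h34.trans_le h1)
  refine ⟨K, ?_⟩
  have hc := prob_compl_eq_one_sub (μ := P) (measurableSet_finite_reach S K).compl
  rw [compl_compl] at hc
  rw [hc]
  refine tsub_le_iff_right.2 ?_
  calc (1 : ENNReal) = 1 / 4 + 3 / 4 := by
        rw [ENNReal.div_add_div_same]
        norm_num
        rw [ENNReal.div_self] <;> norm_num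
    _ ≤ _ := by gcongr

/-- If `ρ ≤ 1 / 2`, there is no uniqueness for `p < 1 / d`. -/
theorem one_le_mul_of_measure_uniqueEvent_eq_one [Countable Γ] [Infinite Γ]
    (hrho : specRad S ≤ 1 / 2) (hP : IsBernoulli S p P) (hp : 0 ≤ p)
    (hU : P (UniqueEvent S) = 1) : 1 ≤ p * d := by
  classical
  by_contra! hpd
  have := hP.1
  have hpd0 : 0 ≤ p * d := by positivity
  obtain ⟨K, hK⟩ := exists_measure_finite_reach_le hP hU
  obtain ⟨m, hm⟩ : ∃ m : ℕ,
      (K.card : ℝ) * (K.card * ((p * d) ^ m / (1 - p * d))) < 1 / 4 := by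
    have h : Filter.Tendsto
        (fun m : ℕ => (K.card : ℝ) * (K.card * ((p * d) ^ m / (1 - p * d)))) Filter.atTop
        (nhds (K.card * (K.card * (0 / (1 - p * d))))) :=
      (((tendsto_pow_atTop_nhds_zero_of_lt_one hpd0 hpd).div_const _).const_mul _).const_mul _
    simp only [zero_div, mul_zero] at h
    exact (h.eventually_lt_const (by norm_num)).exists
  let B : Finset Γ := (Finset.range m).biUnion fun n => (wordsOfLength d n).image (wordProd S)
  obtain ⟨g, hg⟩ := Infinite.exists_notMem_finset
    ((K ×ˢ (B ×ˢ K)).image fun q : Γ × Γ × Γ => q.1 * q.2.1 * q.2.2⁻¹)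
  let L : Finset Γ := K.image (g * ·)
  have hfar : ∀ u ∈ K, ∀ v ∈ L,
      P {ω | OpenConn S ω u v} ≤ ENNReal.ofReal ((p * d) ^ m / (1 - p * d)) := by
    intro u hu v hv
    refine measure_openConn_le hrho hP hp hpd m fun w hw huv => hg ?_
    obtain ⟨k, hk, rfl⟩ := Finset.mem_image.1 hv
    refine Finset.mem_image.2 ⟨(u, wordProd S w, k), ?_, by simp [huv]⟩
    simp only [Finset.mem_product, B, Finset.mem_biUnion, Finset.mem_range, Finset.mem_image]
    exact ⟨hu, ⟨_, hw, w, mem_wordsOfLength.2 rfl, rfl⟩, hk⟩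
  have hcover : UniqueEvent S ⊆ ({ω | (Reach S ω K).Finite} ∪ {ω | (Reach S ω L).Finite}) ∪
      ⋃ u ∈ K, ⋃ v ∈ L, {ω | OpenConn S ω u v} := by
    intro ω hω
    by_cases hωK : (Reach S ω K).Finite
    · exact .inl (.inl hωK)
    by_cases hωL : (Reach S ω L).Finite
    · exact .inl (.inr hωL)
    obtain ⟨u, hu, huc⟩ := exists_infinite_cluster hωK
    obtain ⟨v, hv, hvc⟩ := exists_infinite_cluster hωL
    have heq : Cluster S ω u = Cluster S ω v :=
      ExistsUnique.unique hω ⟨⟨u, rfl⟩, huc⟩ ⟨⟨v, rfl⟩, hvc⟩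
    have hvv : v ∈ Cluster S ω v := Relation.ReflTransGen.refl
    rw [← heq] at hvv
    exact .inr (mem_iUnion₂.2 ⟨u, hu, mem_iUnion₂.2 ⟨v, hv, hvv⟩⟩)
  have hconn : P (⋃ u ∈ K, ⋃ v ∈ L, {ω | OpenConn S ω u v}) ≤ ENNReal.ofReal
      (K.card * (K.card * ((p * d) ^ m / (1 - p * d)))) := by
    have hL : L.card = K.card := Finset.card_image_of_injective _ (mul_right_injective g)
    calc _ ≤ ∑ u ∈ K, ∑ v ∈ L, P {ω | OpenConn S ω u v} :=
          (measure_biUnion_finset_le _ _).trans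
            (Finset.sum_le_sum fun u _ => measure_biUnion_finset_le _ _)
      _ ≤ ∑ u ∈ K, ∑ v ∈ L, ENNReal.ofReal ((p * d) ^ m / (1 - p * d)) :=
          Finset.sum_le_sum fun u hu => Finset.sum_le_sum fun v hv => hfar u hu v hv
      _ = _ := by
          simp only [Finset.sum_const, nsmul_eq_mul, hL]
          rw [ENNReal.ofReal_mul (Nat.cast_nonneg _), ENNReal.ofReal_mul (Nat.cast_nonneg _),
            ENNReal.ofReal_natCast]
  have hquarter : (1 / 4 : ENNReal) = ENNReal.ofReal (1 / 4) := by
    rw [ENNReal.ofReal_div_of_pos (by norm_num)]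
    simp
  have hle : (1 : ENNReal) ≤ ENNReal.ofReal (1 / 4) + ENNReal.ofReal (1 / 4) +
      ENNReal.ofReal (1 / 4) := by
    rw [← hU]
    refine (measure_mono hcover).trans ((measure_union_le _ _).trans (add_le_add
      ((measure_union_le _ _).trans (add_le_add ?_ ?_)) ?_))
    · exact hK.trans hquarter.le
    · exact (measure_finite_reach_translate_le hP g K).trans (hK.trans hquarter.le)
    · exact hconn.trans (ENNReal.ofReal_le_ofReal hm.le)
  rw [← ENNReal.ofReal_add (by norm_num) (by norm_num),
    ← ENNReal.ofReal_add (by norm_num) (by norm_num), ENNReal.one_le_ofReal] at hle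
  norm_num at hle

/-- At `p = 1` there is exactly one infinite cluster. -/
theorem measure_uniqueEvent_eq_one [Countable Γ] [Infinite Γ]
    (hgen : Subgroup.closure (Set.range S) = ⊤) (hP : IsBernoulli S 1 P) :
    P (UniqueEvent S) = 1 := by
  have := hP.1
  have hopen : ∀ᵐ ω ∂P, ∀ e, ω e = true := by
    refine ae_all_iff.2 fun e => ?_
    have h : P {ω | ω e = true} = 1 := by simpa using hP.2 {e} fun _ => true
    have hmeas : MeasurableSet {ω : Γ × Fin d → Bool | ω e = true} :=
      measurableSet_eq_fun (measurable_pi_apply e) measurable_const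
    exact (mem_ae_iff_prob_eq_one hmeas).2 h
  have hae : UniqueEvent S =ᵐ[P] univ := by
    refine Filter.eventuallyEq_univ.2 ?_
    filter_upwards [hopen] with ω hω
    have hcl : ∀ v, Cluster S ω v = univ := fun v =>
      eq_univ_of_forall fun u => openConn_of_forall_eq_true hgen hω v u
    refine ⟨univ, ⟨⟨1, (hcl 1).symm⟩, infinite_univ⟩, ?_⟩
    rintro _ ⟨⟨v, rfl⟩, -⟩
    exact hcl v
  rw [measure_congr hae, measure_univ]

end Uniqueness

/-- If `G = Cay(Γ, S)` is a Cayley graph of an infinite finitely generated group with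
`ρ(G) ≤ 1/2`, then `p_c(G) < p_u(G)`. -/
theorem pc_lt_pu_of_specRad_le_half (Γ : Type) [Group Γ] [Infinite Γ] (d : ℕ)
    (S : Fin d → Γ) (hgen : Subgroup.closure (Set.range S) = ⊤)
    (hrho : specRad S ≤ 1 / 2) :
    pc S < pu S := by
  have hsurj : Function.Surjective (wordProd S) := exists_wordProd_eq hgen
  have : Countable Γ := hsurj.countable
  have hd : 0 < d := by
    refine Nat.pos_of_ne_zero ?_
    rintro rfl
    have : Subsingleton Γ := ⟨fun a b => by
      obtain ⟨v, rfl⟩ := hsurj a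
      obtain ⟨w, rfl⟩ := hsurj b
      rw [Subsingleton.elim v w]⟩
    exact not_finite Γ
  have hd' : (0 : ℝ) < d := by exact_mod_cast hd
  have hd1 : (1 : ℝ) ≤ d := by exact_mod_cast hd
  obtain ⟨q, hq1, hq2⟩ : ∃ q : ℝ, 1 / ((d : ℝ) + 1) < q ∧ q < 1 / d :=
    exists_between (one_div_lt_one_div_of_lt hd' (by linarith))
  have hq0 : 0 < q := lt_trans (by positivity) hq1
  have hq_lt : q < 1 := hq2.trans_le ((div_le_one hd').2 hd1)
  have hpc : pc S ≤ q := by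
    refine csInf_le ⟨0, fun c hc => hc.1.1⟩ ⟨⟨hq0.le, hq_lt.le⟩, fun P hP => ?_⟩
    exact measure_percEvent_eq_one hP hq0 hq_lt ((div_lt_iff₀ (by positivity)).1 hq1)
      (card_le_card_edgeBdry hrho)
  have hpu : 1 / (d : ℝ) ≤ pu S := by
    refine le_csInf ⟨1, ⟨zero_le_one, le_rfl⟩, fun P hP =>
      measure_uniqueEvent_eq_one hgen hP⟩ fun p hp => ?_
    obtain ⟨P, hP⟩ := exists_isBernoulli S hp.1
    exact (div_le_iff₀ hd').2
      (one_le_mul_of_measure_uniqueEvent_eq_one hrho hP hp.1.1 (hp.2 P hP))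
  exact hpc.trans_lt (hq2.trans_le hpu)

end
end
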